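/- Let 0 < k < n and let P be a positive tropical Plücker vector on the k-subsets of [n]. Say that a positive tropical Plücker vector Q refines P if for every μ ∈ ℝⁿ there exists λ ∈ ℝⁿ with Face_Q(μ) ⊆ Face_P(λ); and say the subdivision D_P is finest if every positive tropical Plücker vector Q refining P satisfies { Face_Q(μ) : μ ∈ ℝⁿ } = { Face_P(λ) : λ ∈ ℝⁿ }. Then D_P is finest if and only if every octahedron in D_P is subdivided, i.e., for every (k−2)-element subset S of [n] and all a < b < c < d in [n] ∖ S one has P(S∪{a,b}) + P(S∪{c,d}) ≠ P(S∪{a,d}) + P(S∪{b,c}). -/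

import Mathlib

/-- `P` is a positive tropical Plücker vector. -/
def IsPosTropPlucker (n k : ℕ) (P : Finset (Fin n) → ℝ) : Prop :=
  ∀ S : Finset (Fin n), S.card + 2 = k →
    ∀ a b c d : Fin n, a < b → b < c → c < d →
      a ∉ S → b ∉ S → c ∉ S → d ∉ S →
      ((P (S ∪ {a, c}) + P (S ∪ {b, d}) = P (S ∪ {a, b}) + P (S ∪ {c, d}) ∧
        P (S ∪ {a, b}) + P (S ∪ {c, d}) ≤ P (S ∪ {a, d}) + P (S ∪ {b, c})) ∨
       (P (S ∪ {a, c}) + P (S ∪ {b, d}) = P (S ∪ {a, d}) + P (S ∪ {b, c}) ∧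
        P (S ∪ {a, d}) + P (S ∪ {b, c}) ≤ P (S ∪ {a, b}) + P (S ∪ {c, d})))

/-- The vertex set of the face of the regular subdivision `D_P` of the hypersimplex
selected by `λ`: the `k`-subsets `I` maximizing `∑_{i ∈ I} λ_i - P(I)`. -/
def FaceOf (n k : ℕ) (P : Finset (Fin n) → ℝ) (lam : Fin n → ℝ) : Set (Finset (Fin n)) :=
  {I | I.card = k ∧ ∀ J : Finset (Fin n), J.card = k →
    (∑ i ∈ J, lam i) - P J ≤ (∑ i ∈ I, lam i) - P I}

/-- `Q` refines `P`: every face of `D_Q` is contained in a face of `D_P`. -/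
def Refines (n k : ℕ) (Q P : Finset (Fin n) → ℝ) : Prop :=
  ∀ μ : Fin n → ℝ, ∃ lam : Fin n → ℝ, FaceOf n k Q μ ⊆ FaceOf n k P lam

/-- The regular positroidal subdivision `D_P` is finest: every positive tropical
Plücker vector refining `P` induces the same subdivision. -/
def IsFinest (n k : ℕ) (P : Finset (Fin n) → ℝ) : Prop :=
  ∀ Q : Finset (Fin n) → ℝ, IsPosTropPlucker n k Q → Refines n k Q P →
    Set.range (FaceOf n k Q) = Set.range (FaceOf n k P)

/-- Every octahedron of the subdivision induced by `P` is subdivided. -/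
def OctahedraSubdivided (n k : ℕ) (P : Finset (Fin n) → ℝ) : Prop :=
  ∀ S : Finset (Fin n), S.card + 2 = k →
    ∀ a b c d : Fin n, a < b → b < c → c < d →
      a ∉ S → b ∉ S → c ∉ S → d ∉ S →
      P (S ∪ {a, b}) + P (S ∪ {c, d}) ≠ P (S ∪ {a, d}) + P (S ∪ {b, c})

/-- Exchange the element `x` of `A` for `y`. -/
def swap {n : ℕ} (A : Finset (Fin n)) (x y : Fin n) : Finset (Fin n) :=
  insert y (A.erase x)

/-- The three-term tropical Plücker relations, with no sign or order condition, written around a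
basis `A`. -/
def IsTropPlucker (n k : ℕ) (P : Finset (Fin n) → ℝ) : Prop :=
  ∀ A : Finset (Fin n), A.card = k → ∀ x ∈ A, ∀ u ∈ A, ∀ y ∉ A, ∀ v ∉ A, x ≠ u → y ≠ v →
    min (P (swap A x y) + P (swap A u v)) (P (swap A x v) + P (swap A u y)) ≤
        P A + P (swap (swap A x y) u v) ∧
      min (P A + P (swap (swap A x y) u v)) (P (swap A x v) + P (swap A u y)) ≤
        P (swap A x y) + P (swap A u v)

/-- No octahedron has its three diagonals at the same height. -/
def NoTie (n k : ℕ) (P : Finset (Fin n) → ℝ) : Prop :=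
  ∀ A : Finset (Fin n), A.card = k → ∀ x ∈ A, ∀ u ∈ A, ∀ y ∉ A, ∀ v ∉ A, x ≠ u → y ≠ v →
    ¬ (P A + P (swap (swap A x y) u v) = P (swap A x y) + P (swap A u v) ∧
      P A + P (swap (swap A x y) u v) = P (swap A x v) + P (swap A u y))

theorem card_swap {n : ℕ} {A : Finset (Fin n)} {x y : Fin n} (hx : x ∈ A) (hy : y ∉ A) :
    (swap A x y).card = A.card := by
  have h : y ∉ A.erase x := fun h => hy (Finset.mem_of_mem_erase h)
  rw [swap, Finset.card_insert_of_notMem h, Finset.card_erase_add_one hx]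

theorem mem_swap {n : ℕ} {A : Finset (Fin n)} {x y z : Fin n} :
    z ∈ swap A x y ↔ z = y ∨ (z ≠ x ∧ z ∈ A) := by
  simp [swap]

theorem swap_swap_comm {n : ℕ} {A : Finset (Fin n)} {x u y v : Fin n} (hx : x ∈ A) (hu : u ∈ A)
    (hy : y ∉ A) (hv : v ∉ A) : swap (swap A x y) u v = swap (swap A u v) x y := by
  ext z
  simp only [mem_swap]
  grind

theorem swap_swap_comm' {n : ℕ} {A : Finset (Fin n)} {x u y v : Fin n} (hu : u ∈ A)
    (hy : y ∉ A) (hv : v ∉ A) : swap (swap A x y) u v = swap (swap A x v) u y := by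
  ext z
  simp only [mem_swap]
  grind

theorem sum_swap {n : ℕ} {A : Finset (Fin n)} {x y : Fin n} (hx : x ∈ A) (hy : y ∉ A)
    (f : Fin n → ℝ) : ∑ i ∈ swap A x y, f i = ∑ i ∈ A, f i - f x + f y := by
  have h : y ∉ A.erase x := fun h => hy (Finset.mem_of_mem_erase h)
  rw [swap, Finset.sum_insert h, ← Finset.add_sum_erase A f hx]
  ring

/-- Presentation of the vertices of an octahedron around one of them. -/
theorem octahedron_vertices {n : ℕ} {A : Finset (Fin n)} {x u y v : Fin n} (hx : x ∈ A)
    (hu : u ∈ A) (hy : y ∉ A) (hv : v ∉ A) (hxu : x ≠ u) :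
    ∃ S : Finset (Fin n), S.card + 2 = A.card ∧ x ∉ S ∧ u ∉ S ∧ y ∉ S ∧ v ∉ S ∧
      A = S ∪ {x, u} ∧ swap A x y = S ∪ {u, y} ∧ swap A u v = S ∪ {x, v} ∧
      swap A x v = S ∪ {u, v} ∧ swap A u y = S ∪ {x, y} ∧
      swap (swap A x y) u v = S ∪ {y, v} := by
  refine ⟨(A.erase x).erase u, ?_, ?_, ?_, ?_, ?_, ?_, ?_, ?_, ?_, ?_, ?_⟩
  · have h1 : u ∈ A.erase x := Finset.mem_erase.2 ⟨hxu.symm, hu⟩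
    have h2 := Finset.card_erase_add_one h1
    have h3 := Finset.card_erase_add_one hx
    omega
  all_goals first
    | (simp only [Finset.mem_erase]; tauto)
    | (ext z; simp only [mem_swap, Finset.mem_union, Finset.mem_erase, Finset.mem_insert,
        Finset.mem_singleton]; grind)

theorem four_sort {α : Type*} [LinearOrder α] (p : α → α → α → α → Prop)
    (h12 : ∀ a b c d, p a b c d → p b a c d) (h23 : ∀ a b c d, p a b c d → p a c b d)
    (h34 : ∀ a b c d, p a b c d → p a b d c) (hs : ∀ a b c d, a < b → b < c → c < d → p a b c d)
    {a b c d : α} (hab : a ≠ b) (hac : a ≠ c) (had : a ≠ d) (hbc : b ≠ c) (hbd : b ≠ d)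
    (hcd : c ≠ d) : p a b c d := by
  rcases hab.lt_or_gt with h1 | h1 <;> rcases hac.lt_or_gt with h2 | h2 <;>
  rcases had.lt_or_gt with h3 | h3 <;> rcases hbc.lt_or_gt with h4 | h4 <;>
  rcases hbd.lt_or_gt with h5 | h5 <;> rcases hcd.lt_or_gt with h6 | h6 <;> grind

theorem IsPosTropPlucker.isTropPlucker {n k : ℕ} {P : Finset (Fin n) → ℝ}
    (hP : IsPosTropPlucker n k P) : IsTropPlucker n k P := by
  intro A hA x hx u hu y hy v hv hxu hyv
  obtain ⟨S, hS, hxS, huS, hyS, hvS, e1, e2, e3, e4, e5, e6⟩ :=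
    octahedron_vertices hx hu hy hv hxu
  rw [e6, e2, e3, e4, e5, e1]
  have key := four_sort (p := fun a b c d => a ∉ S → b ∉ S → c ∉ S → d ∉ S →
    min (P (S ∪ {a, c}) + P (S ∪ {b, d})) (P (S ∪ {a, d}) + P (S ∪ {b, c})) ≤
      P (S ∪ {a, b}) + P (S ∪ {c, d}) ∧
    min (P (S ∪ {a, b}) + P (S ∪ {c, d})) (P (S ∪ {a, d}) + P (S ∪ {b, c})) ≤
      P (S ∪ {a, c}) + P (S ∪ {b, d}) ∧
    min (P (S ∪ {a, b}) + P (S ∪ {c, d})) (P (S ∪ {a, c}) + P (S ∪ {b, d})) ≤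
      P (S ∪ {a, d}) + P (S ∪ {b, c}))
    (by
      intro a b c d h hb ha hc hd
      have := h ha hb hc hd
      simp only [Finset.pair_comm b a, min_le_iff] at this ⊢
      grind)
    (by
      intro a b c d h ha hc hb hd
      have := h ha hb hc hd
      simp only [Finset.pair_comm c b, min_le_iff] at this ⊢
      grind)
    (by
      intro a b c d h ha hb hd hc
      have := h ha hb hc hd
      simp only [Finset.pair_comm d c, min_le_iff] at this ⊢
      grind)
    (by
      intro a b c d hab hbc hcd ha hb hc hd
      have := hP S (hS.trans hA) a b c d hab hbc hcd ha hb hc hd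
      simp only [min_le_iff]
      grind)
    (a := x) (b := u) (c := y) (d := v) hxu (by grind) (by grind) (by grind) (by grind) hyv
    hxS huS hyS hvS
  simp only [min_le_iff] at key ⊢
  grind

theorem OctahedraSubdivided.noTie {n k : ℕ} {P : Finset (Fin n) → ℝ}
    (hP : OctahedraSubdivided n k P) : NoTie n k P := by
  intro A hA x hx u hu y hy v hv hxu hyv
  obtain ⟨S, hS, hxS, huS, hyS, hvS, e1, e2, e3, e4, e5, e6⟩ :=
    octahedron_vertices hx hu hy hv hxu
  rw [e6, e2, e3, e4, e5, e1]
  have key := four_sort (p := fun a b c d => a ∉ S → b ∉ S → c ∉ S → d ∉ S →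
    ¬ (P (S ∪ {a, b}) + P (S ∪ {c, d}) = P (S ∪ {a, c}) + P (S ∪ {b, d}) ∧
      P (S ∪ {a, b}) + P (S ∪ {c, d}) = P (S ∪ {a, d}) + P (S ∪ {b, c})))
    (by
      intro a b c d h hb ha hc hd
      have := h ha hb hc hd
      simp only [Finset.pair_comm b a] at this ⊢
      grind)
    (by
      intro a b c d h ha hc hb hd
      have := h ha hb hc hd
      simp only [Finset.pair_comm c b] at this ⊢
      grind)
    (by
      intro a b c d h ha hb hd hc
      have := h ha hb hc hd
      simp only [Finset.pair_comm d c] at this ⊢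
      grind)
    (by
      intro a b c d hab hbc hcd ha hb hc hd
      have := hP S (hS.trans hA) a b c d hab hbc hcd ha hb hc hd
      tauto)
    (a := x) (b := u) (c := y) (d := v) hxu (by grind) (by grind) (by grind) (by grind) hyv
    hxS huS hyS hvS
  grind

/-- Subtract the linear function given by `lam` from `P`. -/
def tilt {n : ℕ} (P : Finset (Fin n) → ℝ) (lam : Fin n → ℝ) (I : Finset (Fin n)) : ℝ :=
  P I - ∑ i ∈ I, lam i

/-- The `k`-subsets at which `P` is minimal. -/
def minFace {n : ℕ} (k : ℕ) (P : Finset (Fin n) → ℝ) : Set (Finset (Fin n)) :=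
  {I | I.card = k ∧ ∀ J : Finset (Fin n), J.card = k → P I ≤ P J}

theorem faceOf_eq_minFace {n k : ℕ} (P : Finset (Fin n) → ℝ) (lam : Fin n → ℝ) :
    FaceOf n k P lam = minFace k (tilt P lam) := by
  ext I
  simp only [FaceOf, minFace, tilt, Set.mem_ofPred_eq]
  refine and_congr_right fun _ => forall₂_congr fun J _ => ?_
  constructor <;> intro h <;> linarith

theorem tilt_tilt {n : ℕ} (P : Finset (Fin n) → ℝ) (lam mu : Fin n → ℝ) :
    tilt (tilt P lam) mu = tilt P (lam + mu) := by
  ext I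
  simp only [tilt, Pi.add_apply, Finset.sum_add_distrib]
  ring

theorem tilt_swap {n : ℕ} {A : Finset (Fin n)} {x y : Fin n} (hx : x ∈ A) (hy : y ∉ A)
    (P : Finset (Fin n) → ℝ) (lam : Fin n → ℝ) :
    tilt P lam (swap A x y) = P (swap A x y) - (∑ i ∈ A, lam i - lam x + lam y) := by
  rw [tilt, sum_swap hx hy]

theorem tilt_swap_swap {n : ℕ} {A : Finset (Fin n)} {x u y v : Fin n} (hx : x ∈ A) (hy : y ∉ A)
    (hu : u ∈ A) (hv : v ∉ A) (hxu : x ≠ u) (hyv : y ≠ v)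
    (P : Finset (Fin n) → ℝ) (lam : Fin n → ℝ) :
    tilt P lam (swap (swap A x y) u v) =
      P (swap (swap A x y) u v) - (∑ i ∈ A, lam i - lam x + lam y - lam u + lam v) := by
  rw [tilt, sum_swap, sum_swap hx hy]
  · exact mem_swap.2 (Or.inr ⟨hxu.symm, hu⟩)
  · rw [mem_swap]
    grind

theorem IsTropPlucker.tilt {n k : ℕ} {P : Finset (Fin n) → ℝ} (hP : IsTropPlucker n k P)
    (lam : Fin n → ℝ) : IsTropPlucker n k (tilt P lam) := by
  intro A hA x hx u hu y hy v hv hxu hyv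
  have h := hP A hA x hx u hu y hy v hv hxu hyv
  rw [tilt_swap_swap hx hy hu hv hxu hyv, tilt_swap hx hy, tilt_swap hu hv, tilt_swap hx hv,
    tilt_swap hu hy, _root_.tilt]
  simp only [min_le_iff] at h ⊢
  refine ⟨h.1.imp ?_ ?_, h.2.imp ?_ ?_⟩ <;> intro h <;> linarith

theorem NoTie.tilt {n k : ℕ} {P : Finset (Fin n) → ℝ} (hP : NoTie n k P)
    (lam : Fin n → ℝ) : NoTie n k (tilt P lam) := by
  intro A hA x hx u hu y hy v hv hxu hyv
  have h := hP A hA x hx u hu y hy v hv hxu hyv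
  rw [tilt_swap_swap hx hy hu hv hxu hyv, tilt_swap hx hy, tilt_swap hu hv, tilt_swap hx hv,
    tilt_swap hu hy, _root_.tilt]
  refine fun h' => h ⟨?_, ?_⟩
  · linarith [h'.1]
  · linarith [h'.2]

theorem exists_pos_forall_mul_lt {α : Type*} [Finite α] (g h : α → ℝ) :
    ∃ δ > 0, ∀ i, 0 < g i → δ * h i < g i := by
  have key : ∀ᶠ δ in nhdsWithin (0 : ℝ) (Set.Ioi 0), ∀ i, 0 < g i → δ * h i < g i := by
    refine Filter.eventually_all.2 fun i => ?_
    by_cases hi : 0 < g i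
    · have ht : Filter.Tendsto (fun δ : ℝ => δ * h i) (nhdsWithin 0 (Set.Ioi 0)) (nhds 0) := by
        have : Filter.Tendsto (fun δ : ℝ => δ * h i) (nhds 0) (nhds (0 * h i)) :=
          (continuous_id.mul continuous_const).tendsto 0
        rw [zero_mul] at this
        exact this.mono_left nhdsWithin_le_nhds
      filter_upwards [ht.eventually_lt_const hi] with δ hδ _ using hδ
    · exact Filter.Eventually.of_forall fun δ h' => absurd h' hi
  obtain ⟨δ, h1, h2⟩ := (key.and self_mem_nhdsWithin).exists
  exact ⟨δ, h2, h1⟩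

theorem minFace_nonempty {n k : ℕ} (hkn : k ≤ n) (P : Finset (Fin n) → ℝ) :
    (minFace k P).Nonempty := by
  have hne : (Finset.powersetCard k (Finset.univ : Finset (Fin n))).Nonempty :=
    Finset.powersetCard_nonempty.2 (by simpa using hkn)
  obtain ⟨A, hA, hmin⟩ := Finset.exists_min_image _ P hne
  refine ⟨A, (Finset.mem_powersetCard.1 hA).2, fun J hJ => hmin J ?_⟩
  exact Finset.mem_powersetCard.2 ⟨Finset.subset_univ _, hJ⟩

theorem minFace_eq_of_mem {n k : ℕ} {P : Finset (Fin n) → ℝ} {A B : Finset (Fin n)}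
    (hA : A ∈ minFace k P) (hB : B ∈ minFace k P) : P A = P B :=
  le_antisymm (hA.2 B hB.1) (hB.2 A hA.1)

theorem mem_minFace_of_le {n k : ℕ} {P : Finset (Fin n) → ℝ} {A B : Finset (Fin n)}
    (hA : A ∈ minFace k P) (hB : B.card = k) (h : P B ≤ P A) : B ∈ minFace k P :=
  ⟨hB, fun J hJ => h.trans (hA.2 J hJ)⟩

theorem lt_of_notMem_minFace {n k : ℕ} {P : Finset (Fin n) → ℝ} {A B : Finset (Fin n)}
    (hA : A ∈ minFace k P) (hB : B.card = k) (h : B ∉ minFace k P) : P A < P B := by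
  by_contra hle
  exact h (mem_minFace_of_le hA hB (not_lt.1 hle))

theorem swap_sdiff {n : ℕ} {A B : Finset (Fin n)} {x y : Fin n} (hy : y ∈ B) :
    swap A x y \ B = (A \ B).erase x := by
  rw [swap, Finset.insert_sdiff_of_mem _ hy, Finset.erase_sdiff_comm]

/-- A basis which is minimal among its neighbours in the direction of `B` is at most `B`. -/
theorem IsTropPlucker.le_of_local_min {n k : ℕ} {P : Finset (Fin n) → ℝ}
    (hP : IsTropPlucker n k P) {B : Finset (Fin n)} (hB : B.card = k) :
    ∀ (d : ℕ) (A : Finset (Fin n)), A.card = k → (A \ B).card = d →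
      (∀ x ∈ A \ B, ∀ y ∈ B \ A, P A ≤ P (swap A x y)) → P A ≤ P B := by
  intro d
  induction d with
  | zero =>
    intro A hA hd _
    have h1 : A ⊆ B := Finset.sdiff_eq_empty_iff_subset.1 (Finset.card_eq_zero.1 hd)
    rw [Finset.eq_of_subset_of_card_le h1 (by omega)]
  | succ d ih =>
    intro A hA hd hmin
    have hd' : (B \ A).card = d + 1 := by
      rw [← hd]; exact Finset.card_sdiff_comm (by omega)
    have hne : ((A \ B) ×ˢ (B \ A)).Nonempty :=
      Finset.Nonempty.product (Finset.card_pos.1 (by omega)) (Finset.card_pos.1 (by omega))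
    obtain ⟨⟨x, y⟩, hxy, hbest⟩ :=
      Finset.exists_min_image _ (fun q : Fin n × Fin n => P (swap A q.1 q.2)) hne
    have hx : x ∈ A \ B := (Finset.mem_product.1 hxy).1
    have hy : y ∈ B \ A := (Finset.mem_product.1 hxy).2
    obtain ⟨hxA, hxB⟩ := Finset.mem_sdiff.1 hx
    obtain ⟨hyB, hyA⟩ := Finset.mem_sdiff.1 hy
    refine (hmin x hx y hy).trans (ih (swap A x y) ((card_swap hxA hyA).trans hA) ?_ ?_)
    · rw [swap_sdiff hyB, Finset.card_erase_of_mem hx, hd]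
      rfl
    · intro u hu v hv
      have hu' : u ≠ x ∧ u ∈ A ∧ u ∉ B := by
        simp only [Finset.mem_sdiff, mem_swap] at hu
        grind
      have hv' : v ≠ y ∧ v ∉ A ∧ v ∈ B := by
        simp only [Finset.mem_sdiff, mem_swap] at hv
        grind
      have hu2 : u ∈ A \ B := Finset.mem_sdiff.2 hu'.2
      have hv2 : v ∈ B \ A := Finset.mem_sdiff.2 ⟨hv'.2.2, hv'.2.1⟩
      have h3 := (hP A hA x hxA u hu'.2.1 y hyA v hv'.2.1 hu'.1.symm hv'.1.symm).1
      have b1 := hbest (u, v) (Finset.mk_mem_product hu2 hv2)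
      have b2 := hbest (x, v) (Finset.mk_mem_product hx hv2)
      have b3 := hbest (u, y) (Finset.mk_mem_product hu2 hy)
      have b4 := hmin x hx y hy
      simp only at b1 b2 b3
      rcases min_le_iff.1 h3 with h | h <;> linarith

theorem IsTropPlucker.le_of_forall_swap {n k : ℕ} {P : Finset (Fin n) → ℝ}
    (hP : IsTropPlucker n k P) {A : Finset (Fin n)} (hA : A.card = k)
    (h : ∀ x ∈ A, ∀ y ∉ A, P A ≤ P (swap A x y)) : A ∈ minFace k P :=
  ⟨hA, fun _ hB => hP.le_of_local_min hB _ A hA rfl fun x hx y hy =>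
    h x (Finset.mem_sdiff.1 hx).1 y (Finset.mem_sdiff.1 hy).2⟩

/-- The tangent cone of a face at a vertex is generated by the edges of the face. -/
theorem IsTropPlucker.sum_le_of_forall_edge {n k : ℕ} {P : Finset (Fin n) → ℝ}
    (hP : IsTropPlucker n k P) {A B : Finset (Fin n)} (hA : A ∈ minFace k P) (η : Fin n → ℝ)
    (h : ∀ x ∈ A, ∀ y ∉ A, swap A x y ∈ minFace k P → η y ≤ η x) (hB : B ∈ minFace k P) :
    ∑ i ∈ B, η i ≤ ∑ i ∈ A, η i := by
  obtain ⟨δ, hδ, hsmall⟩ := exists_pos_forall_mul_lt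
    (fun q : Fin n × Fin n => P (swap A q.1 q.2) - P A) (fun q => η q.2 - η q.1)
  have hmin : A ∈ minFace k (_root_.tilt P (δ • η)) := by
    refine (hP.tilt _).le_of_forall_swap hA.1 fun x hx y hy => ?_
    rw [tilt_swap hx hy, _root_.tilt]
    simp only [Pi.smul_apply, smul_eq_mul]
    by_cases hF : swap A x y ∈ minFace k P
    · have h1 := minFace_eq_of_mem hA hF
      have h2 := mul_le_mul_of_nonneg_left (h x hx y hy hF) hδ.le
      linarith
    · have h1 := lt_of_notMem_minFace hA ((card_swap hx hy).trans hA.1) hF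
      have h2 := hsmall (x, y) (by simpa using h1)
      simp only at h2
      linarith
  have h1 := hmin.2 B hB.1
  simp only [_root_.tilt, Pi.smul_apply, smul_eq_mul, ← Finset.mul_sum,
    minFace_eq_of_mem hA hB] at h1
  exact le_of_mul_le_mul_left (by linarith) hδ

/-- Any two vertices of a face are joined by a step inside the face. -/
theorem IsTropPlucker.exists_swap_mem {n k : ℕ} {P : Finset (Fin n) → ℝ}
    (hP : IsTropPlucker n k P) {A B : Finset (Fin n)} (hA : A ∈ minFace k P)
    (hB : B ∈ minFace k P) (hAB : A ≠ B) :
    ∃ x ∈ A \ B, ∃ y ∈ B \ A, swap A x y ∈ minFace k P := by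
  by_contra hcon
  push Not at hcon
  have h := hP.sum_le_of_forall_edge hA (fun i => if i ∈ B then 1 else 0) (fun x hx y hy hs => by
    by_cases hyB : y ∈ B
    · by_cases hxB : x ∈ B
      · simp [hxB, hyB]
      · exact absurd hs (hcon x (by simp [hx, hxB]) y (by simp [hy, hyB]))
    · simp only [hyB, if_false]
      split_ifs <;> norm_num) hB
  simp only [Finset.sum_ite_mem, Finset.inter_self, Finset.sum_const, nsmul_eq_mul, mul_one,
    Nat.cast_le] at h
  have h1 : A ∩ B = A := Finset.eq_of_subset_of_card_le Finset.inter_subset_left (by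
    rw [hA.1, ← hB.1]; exact h)
  exact hAB (Finset.eq_of_subset_of_card_le (Finset.inter_eq_left.1 h1) (by rw [hA.1, hB.1]))

theorem exists_swap_mem_diff {n k : ℕ} {P R : Finset (Fin n) → ℝ} (hP : IsTropPlucker n k P)
    (hsub : minFace k R ⊆ minFace k P) (hne : (minFace k R).Nonempty)
    (hneq : minFace k R ≠ minFace k P) :
    ∃ A ∈ minFace k R, ∃ x ∈ A, ∃ y ∉ A, swap A x y ∈ minFace k P ∧ swap A x y ∉ minFace k R := by
  obtain ⟨B, hBP, hBR⟩ := Set.exists_of_ssubset (hsub.ssubset_of_ne hneq)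
  obtain ⟨A, hA, hmin⟩ := Set.exists_min_image (minFace k R) (fun A => (A \ B).card)
    (Set.toFinite _) hne
  obtain ⟨x, hx, y, hy, hs⟩ := hP.exists_swap_mem (hsub hA) hBP (fun h => hBR (h ▸ hA))
  refine ⟨A, hA, x, (Finset.mem_sdiff.1 hx).1, y, (Finset.mem_sdiff.1 hy).2, hs, fun hR => ?_⟩
  have h1 := hmin _ hR
  rw [swap_sdiff (Finset.mem_sdiff.1 hy).1, Finset.card_erase_of_mem hx] at h1
  have := Finset.card_pos.2 ⟨x, hx⟩
  omega

/-- Linear functions that are constant on `F` have all coordinates equal: `F` spans an affine space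
of the dimension of the hypersimplex. -/
def IsSpanning {n : ℕ} (F : Set (Finset (Fin n))) : Prop :=
  ∀ η : Fin n → ℝ, (∀ A ∈ F, ∀ B ∈ F, ∑ i ∈ A, η i = ∑ i ∈ B, η i) → ∀ i j, η i = η j

/-- `y` is reached from `x` by a path with `2 * l + 1` edges in the exchange graph of `F` at `A`. -/
inductive ExchangePath {n : ℕ} (F : Set (Finset (Fin n))) (A : Finset (Fin n)) :
    ℕ → Fin n → Fin n → Prop
  | base {x y : Fin n} : x ∈ A → y ∉ A → swap A x y ∈ F → ExchangePath F A 0 x y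
  | step {l : ℕ} {x v u y : Fin n} : x ∈ A → v ∉ A → swap A x v ∈ F → u ∈ A → swap A u v ∈ F →
      ExchangePath F A l u y → ExchangePath F A (l + 1) x y

theorem ExchangePath.mem_left {n : ℕ} {F : Set (Finset (Fin n))} {A : Finset (Fin n)} {l : ℕ}
    {x y : Fin n} (h : ExchangePath F A l x y) : x ∈ A := by
  cases h <;> assumption

theorem IsTropPlucker.double_swap_mem {n k : ℕ} {P : Finset (Fin n) → ℝ}
    (hP : IsTropPlucker n k P) {A : Finset (Fin n)} (hA : A ∈ minFace k P) {x u y v : Fin n}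
    (hx : x ∈ A) (hu : u ∈ A) (hy : y ∉ A) (hv : v ∉ A) (hxu : x ≠ u) (hyv : y ≠ v)
    (h1 : swap A x y ∈ minFace k P) (h2 : swap A u v ∈ minFace k P)
    (h3 : swap A x v ∉ minFace k P ∨ swap A u y ∉ minFace k P) :
    swap (swap A x y) u v ∈ minFace k P := by
  have huS : u ∈ swap A x y := mem_swap.2 (Or.inr ⟨hxu.symm, hu⟩)
  have hvS : v ∉ swap A x y := by rw [mem_swap]; grind
  have hrel := (hP A hA.1 x hx u hu y hy v hv hxu hyv).2
  have e1 := minFace_eq_of_mem hA h1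
  have e2 := minFace_eq_of_mem hA h2
  have l1 := hA.2 _ ((card_swap hx hv).trans hA.1)
  have l2 := hA.2 _ ((card_swap hu hy).trans hA.1)
  refine mem_minFace_of_le hA ((card_swap huS hvS).trans ((card_swap hx hy).trans hA.1)) ?_
  rcases min_le_iff.1 hrel with h | h
  · linarith
  · rcases h3 with h3 | h3
    · have := lt_of_notMem_minFace hA ((card_swap hx hv).trans hA.1) h3
      linarith
    · have := lt_of_notMem_minFace hA ((card_swap hu hy).trans hA.1) h3
      linarith

theorem IsTropPlucker.double_swap_notMem {n k : ℕ} {P : Finset (Fin n) → ℝ}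
    (hP : IsTropPlucker n k P) {A : Finset (Fin n)} (hA : A ∈ minFace k P) {x u y v : Fin n}
    (hx : x ∈ A) (hu : u ∈ A) (hy : y ∉ A) (hv : v ∉ A) (hxu : x ≠ u) (hyv : y ≠ v)
    (h1 : swap A x y ∉ minFace k P) (h2 : swap A x v ∉ minFace k P) :
    swap (swap A x y) u v ∉ minFace k P := by
  intro hD
  have hrel := (hP A hA.1 x hx u hu y hy v hv hxu hyv).1
  have e1 := minFace_eq_of_mem hA hD
  have l1 := hA.2 _ ((card_swap hu hv).trans hA.1)
  have l2 := hA.2 _ ((card_swap hu hy).trans hA.1)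
  have l3 := lt_of_notMem_minFace hA ((card_swap hx hy).trans hA.1) h1
  have l4 := lt_of_notMem_minFace hA ((card_swap hx hv).trans hA.1) h2
  rcases min_le_iff.1 hrel with h | h <;> linarith

/-- A path survives a pivot on an edge `u, v` when `u` is far from its end. -/
theorem ExchangePath.pivot {n k : ℕ} {R : Finset (Fin n) → ℝ} (hR : IsTropPlucker n k R)
    {A : Finset (Fin n)} (hA : A ∈ minFace k R) {u v : Fin n} (hu : u ∈ A) (hv : v ∉ A)
    (huv : swap A u v ∈ minFace k R) {l : ℕ} {x y : Fin n}
    (h : ExchangePath (minFace k R) A l x y)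
    (hfar : ∀ l' ≤ l, ¬ ExchangePath (minFace k R) A l' u y) :
    ExchangePath (minFace k R) (swap A u v) l x y := by
  have edge : ∀ x ∈ A, ∀ y ∉ A, x ≠ u → swap A x y ∈ minFace k R → swap A u y ∉ minFace k R →
      x ∈ swap A u v ∧ y ∉ swap A u v ∧ swap (swap A u v) x y ∈ minFace k R := by
    intro x hx y hy hxu hxy huy
    have hyv : v ≠ y := fun h => huy (h ▸ huv)
    refine ⟨mem_swap.2 (Or.inr ⟨hxu, hx⟩), by rw [mem_swap]; grind, ?_⟩
    exact hR.double_swap_mem hA hu hx hv hy hxu.symm hyv huv hxy (Or.inl huy)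
  induction h with
  | @base x y hx hy hxy =>
    have huy : swap A u y ∉ minFace k R := fun h => hfar 0 le_rfl (.base hu hy h)
    have hxu : x ≠ u := fun h => huy (h ▸ hxy)
    obtain ⟨h1, h2, h3⟩ := edge x hx y hy hxu hxy huy
    exact .base h1 h2 h3
  | @step l x w x' y hx hw hxw hx' hx'w hp ih =>
    have huw : swap A u w ∉ minFace k R := fun h =>
      hfar (l + 1) le_rfl (.step hu hw h hx' hx'w hp)
    have hxu : x ≠ u := fun h => huw (h ▸ hxw)
    have hx'u : x' ≠ u := fun h => huw (h ▸ hx'w)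
    obtain ⟨h1, h2, h3⟩ := edge x hx w hw hxu hxw huw
    obtain ⟨h4, h5, h6⟩ := edge x' hx' w hw hx'u hx'w huw
    exact .step h1 h2 h3 h4 h6 (ih fun l' hl' => hfar l' (by omega))

theorem no_short_path {n k : ℕ} {P R : Finset (Fin n) → ℝ} (hP : IsTropPlucker n k P)
    (hT : NoTie n k P) (hR : IsTropPlucker n k R) (hsub : minFace k R ⊆ minFace k P) (l : ℕ) :
    ∀ A ∈ minFace k R, ∀ x ∈ A, ∀ y ∉ A, swap A x y ∈ minFace k P → swap A x y ∉ minFace k R →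
      ¬ ExchangePath (minFace k R) A l x y := by
  induction l using Nat.strong_induction_on with
  | _ l ih =>
  intro A hA x hx y hy hxyP hxyR hpath
  cases hpath with
  | base _ _ h => exact hxyR h
  | @step l _ v u _ _ hv hxv hu huv hp =>
  have hxu : x ≠ u := fun h => ih l (by omega) A hA x hx y hy hxyP hxyR (h ▸ hp)
  cases hp with
  | base _ _ huy =>
    have hvy : y ≠ v := fun h => hxyR (h ▸ hxv)
    have hD := hR.double_swap_mem hA hx hu hv hy hxu hvy.symm hxv huy (Or.inl hxyR)
    have e1 := minFace_eq_of_mem (hsub hA) (hsub hD)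
    have e2 := minFace_eq_of_mem (hsub hA) (hsub hxv)
    have e3 := minFace_eq_of_mem (hsub hA) (hsub huv)
    have e4 := minFace_eq_of_mem (hsub hA) (hsub huy)
    have e5 := minFace_eq_of_mem (hsub hA) hxyP
    exact hT A hA.1 x hx u hu v hv y hy hxu hvy.symm ⟨by linarith, by linarith⟩
  | @step l _ v₂ u₂ _ _ hv₂ huv₂ hu₂ hu₂v₂ hp =>
    -- the edge to be exchanged is `u, v₂`
    have hfar : ∀ l' ≤ l, ¬ ExchangePath (minFace k R) A l' u y := fun l' hl' h =>
      ih (l' + 1) (by omega) A hA x hx y hy hxyP hxyR (.step hx hv hxv hu huv h)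
    have hxv₂ : swap A x v₂ ∉ minFace k R := fun h =>
      ih (l + 1) (by omega) A hA x hx y hy hxyP hxyR (.step hx hv₂ h hu₂ hu₂v₂ hp)
    have hu₂v : swap A u₂ v ∉ minFace k R := fun h =>
      ih (l + 1) (by omega) A hA x hx y hy hxyP hxyR (.step hx hv hxv hu₂ h hp)
    have huy : swap A u y ∉ minFace k R := fun h => hfar 0 (by omega) (.base hu hy h)
    have hvv₂ : v₂ ≠ v := fun h => hxv₂ (h ▸ hxv)
    have hyv₂ : v₂ ≠ y := fun h => huy (h ▸ huv₂)
    have huu₂ : u ≠ u₂ := fun h => hu₂v (h ▸ huv)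
    have hxv₂P : swap A x v₂ ∉ minFace k P := fun h =>
      ih 1 (by omega) A hA x hx v₂ hv₂ h hxv₂ (.step hx hv hxv hu huv (.base hu hv₂ huv₂))
    have hpath := hp.pivot hR hA hu hv₂ huv₂ hfar
    have hxB : x ∈ swap A u v₂ := mem_swap.2 (Or.inr ⟨hxu, hx⟩)
    have hvB : v ∉ swap A u v₂ := by rw [mem_swap]; grind
    have hyB : y ∉ swap A u v₂ := by rw [mem_swap]; grind
    have m1 : swap (swap A u v₂) x v ∈ minFace k R :=
      hR.double_swap_mem hA hu hx hv₂ hv hxu.symm hvv₂ huv₂ hxv (Or.inr hxv₂)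
    have m2 : swap (swap A u v₂) u₂ v ∈ minFace k R := by
      rw [swap_swap_comm' hu₂ hv₂ hv]
      exact hR.double_swap_mem hA hu hu₂ hv hv₂ huu₂ hvv₂.symm huv hu₂v₂ (Or.inr hu₂v)
    have m3 : swap (swap A u v₂) x y ∈ minFace k P :=
      hP.double_swap_mem (hsub hA) hu hx hv₂ hy hxu.symm hyv₂ (hsub huv₂) hxyP (Or.inr hxv₂P)
    have m4 : swap (swap A u v₂) x y ∉ minFace k R := by
      rw [swap_swap_comm' hx hv₂ hy, swap_swap_comm hu hx hy hv₂]
      exact hR.double_swap_notMem hA hx hu hv₂ hy hxu hyv₂ hxv₂ hxyR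
    exact ih (l + 1) (by omega) _ huv₂ x hxB y hyB m3 m4
      (.step hxB hvB m1 hpath.mem_left m2 hpath)

/-- If `P` has no tied octahedron, a spanning face contained in a face of `P` is equal to it. -/
theorem minFace_eq_of_subset {n k : ℕ} {P R : Finset (Fin n) → ℝ} (hP : IsTropPlucker n k P)
    (hT : NoTie n k P) (hR : IsTropPlucker n k R) (hsub : minFace k R ⊆ minFace k P)
    (hne : (minFace k R).Nonempty) (hspan : IsSpanning (minFace k R)) :
    minFace k R = minFace k P := by
  classical
  by_contra hneq
  obtain ⟨A, hA, x, hx, y, hy, hxyP, hxyR⟩ := exists_swap_mem_diff hP hsub hne hneq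
  let C : Fin n → Prop := fun i => (∃ l, ExchangePath (minFace k R) A l i y) ∨ i = y ∨
    (i ∉ A ∧ ∃ u ∈ A, swap A u i ∈ minFace k R ∧ ∃ l, ExchangePath (minFace k R) A l u y)
  have hedge : ∀ u ∈ A, ∀ v ∉ A, swap A u v ∈ minFace k R → (C u ↔ C v) := by
    intro u hu v hv huv
    constructor
    · rintro (⟨l, h⟩ | h | h)
      · exact Or.inr (Or.inr ⟨hv, u, hu, huv, l, h⟩)
      · exact absurd hu (h ▸ hy)
      · exact absurd hu h.1
    · rintro (⟨l, h⟩ | h | ⟨_, u', hu', hs, l, hp⟩)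
      · exact absurd h.mem_left hv
      · exact Or.inl ⟨0, .base hu hv huv |> fun q => h ▸ q⟩
      · exact Or.inl ⟨l + 1, .step hu hv huv hu' hs hp⟩
  have hconst : ∀ B ∈ minFace k R,
      ∑ i ∈ B, (if C i then (1 : ℝ) else 0) = ∑ i ∈ A, (if C i then (1 : ℝ) else 0) := by
    intro B hB
    apply le_antisymm
    · refine hR.sum_le_of_forall_edge hA _ (fun u hu v hv h => ?_) hB
      simp only [hedge u hu v hv h]
      exact le_rfl
    · have := hR.sum_le_of_forall_edge hA (fun i => -(if C i then (1 : ℝ) else 0))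
        (fun u hu v hv h => by simp only [hedge u hu v hv h]; exact le_rfl) hB
      simpa [Finset.sum_neg_distrib] using this
  have h := hspan _ (fun B hB B' hB' => (hconst B hB).trans (hconst B' hB').symm) x y
  have hCy : C y := Or.inr (Or.inl rfl)
  have hCx : C x := by
    by_contra hCx
    simp [hCx, hCy] at h
  rcases hCx with ⟨l, hp⟩ | h | h
  · exact no_short_path hP hT hR hsub l A hA x hx y hy hxyP hxyR hp
  · exact hy (h ▸ hx)
  · exact h.1 hx

theorem sum_union_pair {n : ℕ} {S : Finset (Fin n)} {x y : Fin n} (hx : x ∉ S) (hy : y ∉ S)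
    (hxy : x ≠ y) (f : Fin n → ℝ) : ∑ i ∈ S ∪ {x, y}, f i = ∑ i ∈ S, f i + f x + f y := by
  rw [Finset.sum_union, Finset.sum_pair hxy, add_assoc]
  simp [hx, hy]

/-- Four vertices on a square section of an octahedron lie in a common face as soon as the section
is not cut. -/
theorem IsTropPlucker.exists_square_mem {n k : ℕ} {Q : Finset (Fin n) → ℝ}
    (hQ : IsTropPlucker n k Q) {A : Finset (Fin n)} (hA : A.card = k) {x u y v : Fin n}
    (hx : x ∈ A) (hu : u ∈ A) (hy : y ∉ A) (hv : v ∉ A) (hxu : x ≠ u) (hyv : y ≠ v)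
    (h1 : Q A + Q (swap (swap A x y) u v) = Q (swap A x y) + Q (swap A u v))
    (h2 : Q (swap A x y) + Q (swap A u v) ≤ Q (swap A x v) + Q (swap A u y)) :
    ∃ mu : Fin n → ℝ, A ∈ minFace k (_root_.tilt Q mu) ∧ swap A x y ∈ minFace k (_root_.tilt Q mu) ∧
      swap A u v ∈ minFace k (_root_.tilt Q mu) ∧
      swap (swap A x y) u v ∈ minFace k (_root_.tilt Q mu) := by
  obtain ⟨K, hK⟩ := (Set.finite_range
    (fun q : Fin n × Fin n => Q A - Q (swap A q.1 q.2))).bddAbove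
  have hK' : ∀ i j, Q A - Q (swap A i j) ≤ K := fun i j => hK ⟨(i, j), rfl⟩
  obtain ⟨α, hα⟩ : ∃ α, α = Q A - Q (swap A x y) := ⟨_, rfl⟩
  obtain ⟨β, hβ⟩ : ∃ β, β = Q A - Q (swap A u v) := ⟨_, rfl⟩
  obtain ⟨s, hs⟩ : ∃ s, s = Q (swap A x v) - Q A := ⟨_, rfl⟩
  obtain ⟨M, hM⟩ : ∃ M, M = |K| + |α| + |β| + |s| := ⟨_, rfl⟩
  let mu : Fin n → ℝ := fun i => if i = x then 0 else if i = y then -α else if i = u then β + s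
    else if i = v then s else if i ∈ A then M else -M
  have mx : mu x = 0 := by simp [mu]
  have my : mu y = -α := by
    have : y ≠ x := fun h => hy (h ▸ hx)
    simp [mu, this]
  have mu' : mu u = β + s := by
    have : u ≠ y := fun h => hy (h ▸ hu)
    simp [mu, this, hxu.symm]
  have mv : mu v = s := by
    have h1 : v ≠ x := fun h => hv (h ▸ hx)
    have h2 : v ≠ u := fun h => hv (h ▸ hu)
    simp [mu, h1, h2, hyv.symm]
  have bK := le_abs_self K
  have aK := abs_nonneg K
  have aα := abs_nonneg α
  have aβ := abs_nonneg β
  have as' := abs_nonneg s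
  have bα := le_abs_self α
  have bβ := neg_abs_le β
  have bs := le_abs_self s
  have bs' := neg_abs_le s
  have bβ' := le_abs_self β
  have bα' := neg_abs_le α
  have hin : ∀ i ∈ A, i ≠ x → i ≠ u → mu i = M := by
    intro i hi h1 h2
    have h3 : i ≠ y := fun h => hy (h ▸ hi)
    have h4 : i ≠ v := fun h => hv (h ▸ hi)
    simp [mu, h1, h2, h3, h4, hi]
  have hout : ∀ i ∉ A, i ≠ y → i ≠ v → mu i = -M := by
    intro i hi h1 h2
    have h3 : i ≠ x := fun h => hi (h ▸ hx)
    have h4 : i ≠ u := fun h => hi (h ▸ hu)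
    simp [mu, h1, h2, h3, h4, hi]
  have hAm : A ∈ minFace k (_root_.tilt Q mu) := by
    refine (hQ.tilt mu).le_of_forall_swap hA fun i hi j hj => ?_
    rw [tilt_swap hi hj, _root_.tilt]
    have hKij := hK' i j
    by_cases h1 : i = x
    · subst h1
      by_cases h2 : j = y
      · subst h2; rw [mx, my]; linarith
      by_cases h3 : j = v
      · subst h3; rw [mx, mv]; linarith
      rw [mx, hout j hj h2 h3]; linarith
    by_cases h1' : i = u
    · subst h1'
      by_cases h2 : j = y
      · subst h2; rw [mu', my]; linarith
      by_cases h3 : j = v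
      · subst h3; rw [mu', mv]; linarith
      rw [mu', hout j hj h2 h3]; linarith
    rw [hin i hi h1 h1']
    by_cases h2 : j = y
    · subst h2; rw [my]; linarith
    by_cases h3 : j = v
    · subst h3; rw [mv]; linarith
    rw [hout j hj h2 h3]; linarith
  have huS : u ∈ swap A x y := mem_swap.2 (Or.inr ⟨hxu.symm, hu⟩)
  have hvS : v ∉ swap A x y := by rw [mem_swap]; grind
  refine ⟨mu, hAm, mem_minFace_of_le hAm ((card_swap hx hy).trans hA) ?_,
    mem_minFace_of_le hAm ((card_swap hu hv).trans hA) ?_,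
    mem_minFace_of_le hAm ((card_swap huS hvS).trans ((card_swap hx hy).trans hA)) ?_⟩
  · rw [tilt_swap hx hy, _root_.tilt, mx, my]; linarith
  · rw [tilt_swap hu hv, _root_.tilt, mu', mv]; linarith
  · rw [tilt_swap_swap hx hy hu hv hxu hyv, _root_.tilt, mx, my, mu', mv]; linarith

theorem IsTropPlucker.exists_square_mem_faceOf {n k : ℕ} {Q : Finset (Fin n) → ℝ}
    (hQ : IsTropPlucker n k Q) {S : Finset (Fin n)} (hS : S.card + 2 = k) {x u y v : Fin n}
    (hx : x ∉ S) (hu : u ∉ S) (hy : y ∉ S) (hv : v ∉ S) (hxu : x ≠ u) (hxy : x ≠ y) (hxv : x ≠ v)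
    (huy : u ≠ y) (huv : u ≠ v) (hyv : y ≠ v)
    (h1 : Q (S ∪ {x, u}) + Q (S ∪ {y, v}) = Q (S ∪ {u, y}) + Q (S ∪ {x, v}))
    (h2 : Q (S ∪ {x, u}) + Q (S ∪ {y, v}) ≤ Q (S ∪ {u, v}) + Q (S ∪ {x, y})) :
    ∃ mu : Fin n → ℝ, S ∪ {x, u} ∈ FaceOf n k Q mu ∧ S ∪ {y, v} ∈ FaceOf n k Q mu ∧
      S ∪ {u, y} ∈ FaceOf n k Q mu ∧ S ∪ {x, v} ∈ FaceOf n k Q mu := by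
  have hA : (S ∪ {x, u}).card = k := by
    rw [Finset.card_union_of_disjoint (by simp [hx, hu]), Finset.card_pair hxu, hS]
  have e1 : swap (S ∪ {x, u}) x y = S ∪ {u, y} := by
    ext z; simp only [mem_swap, Finset.mem_union, Finset.mem_insert, Finset.mem_singleton]; grind
  have e2 : swap (S ∪ {x, u}) u v = S ∪ {x, v} := by
    ext z; simp only [mem_swap, Finset.mem_union, Finset.mem_insert, Finset.mem_singleton]; grind
  have e3 : swap (S ∪ {x, u}) x v = S ∪ {u, v} := by
    ext z; simp only [mem_swap, Finset.mem_union, Finset.mem_insert, Finset.mem_singleton]; grind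
  have e4 : swap (S ∪ {x, u}) u y = S ∪ {x, y} := by
    ext z; simp only [mem_swap, Finset.mem_union, Finset.mem_insert, Finset.mem_singleton]; grind
  have e5 : swap (S ∪ {u, y}) u v = S ∪ {y, v} := by
    ext z; simp only [mem_swap, Finset.mem_union, Finset.mem_insert, Finset.mem_singleton]; grind
  obtain ⟨mu, m1, m2, m3, m4⟩ := hQ.exists_square_mem hA (x := x) (u := u) (y := y) (v := v)
    (by simp) (by simp) (by simp [hy, hxy.symm, huy.symm]) (by simp [hv, hxv.symm, huv.symm])
    hxu hyv (by rw [e1, e2, e5, h1]) (by rw [e1, e2, e3, e4, ← h1]; exact h2)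
  rw [e1] at m2 m4
  rw [e2] at m3
  rw [e5] at m4
  exact ⟨mu, by rwa [faceOf_eq_minFace], by rwa [faceOf_eq_minFace], by rwa [faceOf_eq_minFace],
    by rwa [faceOf_eq_minFace]⟩

theorem eq_of_square_mem_faceOf {n k : ℕ} {P : Finset (Fin n) → ℝ} {S : Finset (Fin n)}
    {x u y v : Fin n} {lam : Fin n → ℝ} (hx : x ∉ S) (hu : u ∉ S) (hy : y ∉ S) (hv : v ∉ S)
    (hxu : x ≠ u) (hxv : x ≠ v) (huy : u ≠ y) (hyv : y ≠ v)
    (h1 : S ∪ {x, u} ∈ FaceOf n k P lam) (h2 : S ∪ {y, v} ∈ FaceOf n k P lam)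
    (h3 : S ∪ {u, y} ∈ FaceOf n k P lam) (h4 : S ∪ {x, v} ∈ FaceOf n k P lam) :
    P (S ∪ {x, u}) + P (S ∪ {y, v}) = P (S ∪ {u, y}) + P (S ∪ {x, v}) := by
  rw [faceOf_eq_minFace] at h1 h2 h3 h4
  have e1 := minFace_eq_of_mem h1 h2
  have e2 := minFace_eq_of_mem h1 h3
  have e3 := minFace_eq_of_mem h1 h4
  simp only [tilt, sum_union_pair hx hu hxu, sum_union_pair hy hv hyv, sum_union_pair hu hy huy,
    sum_union_pair hx hv hxv] at e1 e2 e3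
  linarith

/-- A square section which is not cut by `Q` is not cut by a coarsening `P` of `Q`. -/
theorem Refines.square_eq {n k : ℕ} {P Q : Finset (Fin n) → ℝ} (hQP : Refines n k Q P)
    (hQ : IsTropPlucker n k Q) {S : Finset (Fin n)} (hS : S.card + 2 = k) {x u y v : Fin n}
    (hx : x ∉ S) (hu : u ∉ S) (hy : y ∉ S) (hv : v ∉ S) (hxu : x ≠ u) (hxy : x ≠ y) (hxv : x ≠ v)
    (huy : u ≠ y) (huv : u ≠ v) (hyv : y ≠ v)
    (h1 : Q (S ∪ {x, u}) + Q (S ∪ {y, v}) = Q (S ∪ {u, y}) + Q (S ∪ {x, v}))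
    (h2 : Q (S ∪ {x, u}) + Q (S ∪ {y, v}) ≤ Q (S ∪ {u, v}) + Q (S ∪ {x, y})) :
    P (S ∪ {x, u}) + P (S ∪ {y, v}) = P (S ∪ {u, y}) + P (S ∪ {x, v}) := by
  obtain ⟨mu, m1, m2, m3, m4⟩ :=
    hQ.exists_square_mem_faceOf hS hx hu hy hv hxu hxy hxv huy huv hyv h1 h2
  obtain ⟨lam, hl⟩ := hQP mu
  exact eq_of_square_mem_faceOf hx hu hy hv hxu hxv huy hyv (hl m1) (hl m2) (hl m3) (hl m4)

/-- The two ways in which a coarsening inherits the positive tropical Plücker relation. -/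
theorem Refines.sorted_eq {n k : ℕ} {P Q : Finset (Fin n) → ℝ} (hQP : Refines n k Q P)
    (hQ : IsTropPlucker n k Q) {S : Finset (Fin n)} (hS : S.card + 2 = k) {a b c d : Fin n}
    (hab : a < b) (hbc : b < c) (hcd : c < d) (ha : a ∉ S) (hb : b ∉ S) (hc : c ∉ S) (hd : d ∉ S) :
    (Q (S ∪ {a, c}) + Q (S ∪ {b, d}) = Q (S ∪ {a, b}) + Q (S ∪ {c, d}) →
      Q (S ∪ {a, b}) + Q (S ∪ {c, d}) ≤ Q (S ∪ {a, d}) + Q (S ∪ {b, c}) →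
      P (S ∪ {a, c}) + P (S ∪ {b, d}) = P (S ∪ {a, b}) + P (S ∪ {c, d})) ∧
    (Q (S ∪ {a, c}) + Q (S ∪ {b, d}) = Q (S ∪ {a, d}) + Q (S ∪ {b, c}) →
      Q (S ∪ {a, d}) + Q (S ∪ {b, c}) ≤ Q (S ∪ {a, b}) + Q (S ∪ {c, d}) →
      P (S ∪ {a, c}) + P (S ∪ {b, d}) = P (S ∪ {a, d}) + P (S ∪ {b, c})) := by
  have hac := hab.trans hbc
  have hbd := hbc.trans hcd
  have had := hac.trans hcd
  constructor
  · intro h1 h2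
    have := hQP.square_eq hQ hS ha hc hd hb hac.ne had.ne hab.ne hcd.ne hbc.ne' hbd.ne'
    rw [Finset.pair_comm d b, Finset.pair_comm c b] at this
    exact (this (by linarith) (by linarith)).trans (by ring)
  · intro h1 h2
    have := hQP.square_eq hQ hS ha hc hb hd hac.ne hab.ne had.ne hbc.ne' hcd.ne hbd.ne
    rw [Finset.pair_comm c b] at this
    exact (this (by linarith) (by linarith)).trans (by ring)

theorem Refines.combination {n k : ℕ} {P Q : Finset (Fin n) → ℝ} (hQP : Refines n k Q P)
    (hP : IsPosTropPlucker n k P) (hPs : OctahedraSubdivided n k P) (hQ : IsPosTropPlucker n k Q)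
    {α β : ℝ} (hα : 0 ≤ α) (hβ : 0 ≤ β) (hαβ : 0 < α + β) :
    IsPosTropPlucker n k (α • P + β • Q) ∧ OctahedraSubdivided n k (α • P + β • Q) := by
  have key : ∀ S : Finset (Fin n), S.card + 2 = k →
    ∀ a b c d : Fin n, a < b → b < c → c < d → a ∉ S → b ∉ S → c ∉ S → d ∉ S →
      ((P (S ∪ {a, c}) + P (S ∪ {b, d}) = P (S ∪ {a, b}) + P (S ∪ {c, d}) ∧
        P (S ∪ {a, b}) + P (S ∪ {c, d}) < P (S ∪ {a, d}) + P (S ∪ {b, c}) ∧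
        Q (S ∪ {a, c}) + Q (S ∪ {b, d}) = Q (S ∪ {a, b}) + Q (S ∪ {c, d}) ∧
        Q (S ∪ {a, b}) + Q (S ∪ {c, d}) < Q (S ∪ {a, d}) + Q (S ∪ {b, c})) ∨
       (P (S ∪ {a, c}) + P (S ∪ {b, d}) = P (S ∪ {a, d}) + P (S ∪ {b, c}) ∧
        P (S ∪ {a, d}) + P (S ∪ {b, c}) < P (S ∪ {a, b}) + P (S ∪ {c, d}) ∧
        Q (S ∪ {a, c}) + Q (S ∪ {b, d}) = Q (S ∪ {a, d}) + Q (S ∪ {b, c}) ∧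
        Q (S ∪ {a, d}) + Q (S ∪ {b, c}) < Q (S ∪ {a, b}) + Q (S ∪ {c, d}))) := by
    intro S hS a b c d hab hbc hcd ha hb hc hd
    obtain ⟨r1, r2⟩ := hQP.sorted_eq hQ.isTropPlucker hS hab hbc hcd ha hb hc hd
    have p := hP S hS a b c d hab hbc hcd ha hb hc hd
    have q := hQ S hS a b c d hab hbc hcd ha hb hc hd
    have t := hPs S hS a b c d hab hbc hcd ha hb hc hd
    generalize P (S ∪ {a, c}) + P (S ∪ {b, d}) = p2 at *
    generalize P (S ∪ {a, b}) + P (S ∪ {c, d}) = p1 at *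
    generalize P (S ∪ {a, d}) + P (S ∪ {b, c}) = p3 at *
    generalize Q (S ∪ {a, c}) + Q (S ∪ {b, d}) = q2 at *
    generalize Q (S ∪ {a, b}) + Q (S ∪ {c, d}) = q1 at *
    generalize Q (S ∪ {a, d}) + Q (S ∪ {b, c}) = q3 at *
    clear hQP hP hPs hQ
    rcases q with ⟨q, q'⟩ | ⟨q, q'⟩
    · have hp := r1 q q'
      have hne : q1 ≠ q3 := fun h => t (hp.symm.trans (r2 (q.trans h) h.ge))
      left
      rcases p with ⟨_, p'⟩ | ⟨p, p'⟩
      · exact ⟨hp, p'.lt_of_ne t, q, q'.lt_of_ne hne⟩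
      · exact absurd (hp.symm.trans p) t
    · have hp := r2 q q'
      have hne : q3 ≠ q1 := fun h => t ((r1 (q.trans h) h.ge).symm.trans hp)
      right
      rcases p with ⟨p, p'⟩ | ⟨p, p'⟩
      · exact absurd (p.symm.trans hp) t
      · exact ⟨hp, p'.lt_of_ne t.symm, q, q'.lt_of_ne hne⟩
  have mul : ∀ p q p' q' : ℝ, p < p' → q < q' → α * p + β * q < α * p' + β * q' := by
    intro p q p' q' h1 h2
    rcases hα.eq_or_lt with h | h
    · have hβ' : 0 < β := by linarith
      nlinarith
    · nlinarith [mul_le_mul_of_nonneg_left h2.le hβ]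
  have lin : ∀ I J : Finset (Fin n), (α • P + β • Q) I + (α • P + β • Q) J =
      α * (P I + P J) + β * (Q I + Q J) := by
    intro I J
    simp only [Pi.add_apply, Pi.smul_apply, smul_eq_mul]
    ring
  constructor
  · intro S hS a b c d hab hbc hcd ha hb hc hd
    simp only [lin]
    rcases key S hS a b c d hab hbc hcd ha hb hc hd with ⟨h1, h2, h3, h4⟩ | ⟨h1, h2, h3, h4⟩
    · exact Or.inl ⟨by rw [h1, h3], (mul _ _ _ _ h2 h4).le⟩
    · exact Or.inr ⟨by rw [h1, h3], (mul _ _ _ _ h2 h4).le⟩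
  · intro S hS a b c d hab hbc hcd ha hb hc hd
    simp only [lin]
    rcases key S hS a b c d hab hbc hcd ha hb hc hd with ⟨h1, h2, h3, h4⟩ | ⟨h1, h2, h3, h4⟩
    · exact (mul _ _ _ _ h2 h4).ne
    · exact (mul _ _ _ _ h2 h4).ne'

/-- The points of `G` at which `f` is minimal on `G`. -/
def argminOn {n : ℕ} (G : Set (Finset (Fin n))) (f : Finset (Fin n) → ℝ) : Set (Finset (Fin n)) :=
  {A | A ∈ G ∧ ∀ B ∈ G, f A ≤ f B}

theorem argminOn_eq {n : ℕ} {G : Set (Finset (Fin n))} {f : Finset (Fin n) → ℝ}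
    {A B : Finset (Fin n)} (hA : A ∈ argminOn G f) (hB : B ∈ argminOn G f) : f A = f B :=
  le_antisymm (hA.2 B hB.1) (hB.2 A hA.1)

theorem exists_argminOn_ssubset {n : ℕ} {G : Set (Finset (Fin n))} {f : Finset (Fin n) → ℝ}
    {η : Fin n → ℝ} {A B₀ : Finset (Fin n)} (hA : A ∈ argminOn G f)
    (hη : ∀ B ∈ argminOn G f, ∑ i ∈ B, η i = ∑ i ∈ A, η i) (hB₀ : B₀ ∈ G)
    (hlt : ∑ i ∈ A, η i < ∑ i ∈ B₀, η i) :
    ∃ mu : Fin n → ℝ, argminOn G f ⊂ argminOn G (tilt f mu) := by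
  obtain ⟨C, ⟨hC, hAC⟩, hmin⟩ := Set.exists_min_image
    {B | B ∈ G ∧ ∑ i ∈ A, η i < ∑ i ∈ B, η i}
    (fun B => (f B - f A) / (∑ i ∈ B, η i - ∑ i ∈ A, η i)) (Set.toFinite _) ⟨B₀, hB₀, hlt⟩
  obtain ⟨t, ht⟩ : ∃ t, t = (f C - f A) / (∑ i ∈ C, η i - ∑ i ∈ A, η i) := ⟨_, rfl⟩
  have hpos : 0 < ∑ i ∈ C, η i - ∑ i ∈ A, η i := sub_pos.2 hAC
  have ht0 : 0 ≤ t := ht ▸ div_nonneg (sub_nonneg.2 (hA.2 C hC)) hpos.le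
  have hCt : f C - f A = t * (∑ i ∈ C, η i - ∑ i ∈ A, η i) := by
    rw [ht, div_mul_cancel₀ _ hpos.ne']
  have hle : ∀ B ∈ G, tilt f (t • η) A ≤ tilt f (t • η) B := by
    intro B hB
    simp only [tilt, Pi.smul_apply, smul_eq_mul, ← Finset.mul_sum]
    by_cases h : ∑ i ∈ A, η i < ∑ i ∈ B, η i
    · have h1 := hmin B ⟨hB, h⟩
      simp only [← ht] at h1
      rw [le_div_iff₀ (sub_pos.2 h)] at h1
      linarith
    · have h1 := mul_le_mul_of_nonneg_left (not_lt.1 h) ht0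
      have h2 := hA.2 B hB
      linarith
  refine ⟨t • η, fun B hB => ⟨hB.1, fun D hD => ?_⟩, fun hsub => ?_⟩
  · refine le_trans (le_of_eq ?_) (hle D hD)
    simp only [tilt, Pi.smul_apply, smul_eq_mul, ← Finset.mul_sum, hη B hB, argminOn_eq hA hB]
  · have hCm : C ∈ argminOn G (tilt f (t • η)) := by
      refine ⟨hC, fun D hD => le_trans (le_of_eq ?_) (hle D hD)⟩
      simp only [tilt, Pi.smul_apply, smul_eq_mul, ← Finset.mul_sum]
      linarith
    exact hAC.ne' (hη C (hsub hCm))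

/-- Every face extends to one on which only the functions constant on `G` are constant. -/
theorem exists_argminOn_superset {n : ℕ} {G : Set (Finset (Fin n))} (hG : G.Nonempty)
    (f : Finset (Fin n) → ℝ) (mu₀ : Fin n → ℝ) :
    ∃ mu : Fin n → ℝ, argminOn G (tilt f mu₀) ⊆ argminOn G (tilt f mu) ∧
      (argminOn G (tilt f mu)).Nonempty ∧
      ∀ η : Fin n → ℝ, (∀ A ∈ argminOn G (tilt f mu), ∀ B ∈ argminOn G (tilt f mu),
        ∑ i ∈ A, η i = ∑ i ∈ B, η i) → ∀ A ∈ G, ∀ B ∈ G, ∑ i ∈ A, η i = ∑ i ∈ B, η i := by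
  obtain ⟨F, hF, hmax⟩ :=
    (Set.toFinite (Set.range fun mu => argminOn G (tilt f mu))).exists_le_maximal
    ⟨mu₀, rfl⟩
  obtain ⟨mu, rfl⟩ := hmax.1
  obtain ⟨A, hA⟩ : (argminOn G (tilt f mu)).Nonempty := Set.exists_min_image G _ (Set.toFinite _) hG
  refine ⟨mu, hF, ⟨A, hA⟩, fun η hη => ?_⟩
  suffices h : ∀ B ∈ G, ∑ i ∈ B, η i = ∑ i ∈ A, η i from
    fun B hB C hC => (h B hB).trans (h C hC).symm
  have key : ∀ η : Fin n → ℝ, (∀ B ∈ argminOn G (tilt f mu), ∑ i ∈ B, η i = ∑ i ∈ A, η i) →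
      ∀ B ∈ G, ∑ i ∈ B, η i ≤ ∑ i ∈ A, η i := by
    intro η hη B hB
    by_contra hlt
    obtain ⟨nu, hnu⟩ := exists_argminOn_ssubset hA hη hB (not_le.1 hlt)
    rw [tilt_tilt] at hnu
    exact hnu.not_subset (hmax.2 ⟨mu + nu, rfl⟩ hnu.subset)
  intro B hB
  refine le_antisymm (key η (fun B hB => hη B hB A hA) B hB) ?_
  have := key (-η) (fun B hB => by simp [hη B hB A hA]) B hB
  simpa using this

theorem minFace_eq_argminOn {n : ℕ} (k : ℕ) (f : Finset (Fin n) → ℝ) :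
    minFace k f = argminOn {I | I.card = k} f := rfl

/-- Every face is contained in a spanning one. -/
theorem exists_spanning_minFace {n k : ℕ} (hk : 0 < k) (hkn : k < n) (P : Finset (Fin n) → ℝ)
    (mu₀ : Fin n → ℝ) : ∃ mu : Fin n → ℝ, minFace k (tilt P mu₀) ⊆ minFace k (tilt P mu) ∧
      IsSpanning (minFace k (tilt P mu)) := by
  simp only [minFace_eq_argminOn]
  obtain ⟨A₀, hA₀⟩ := minFace_nonempty hkn.le P
  obtain ⟨mu, h1, -, h3⟩ := exists_argminOn_superset (G := {I | I.card = k}) ⟨A₀, hA₀.1⟩ P mu₀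
  refine ⟨mu, h1, fun η hη i j => ?_⟩
  by_cases hij : i = j
  · rw [hij]
  obtain ⟨A, hiA, hAj, hA⟩ := Finset.exists_subsuperset_card_eq
    (s := {i}) (t := Finset.univ.erase j) (n := k) (by simp [hij])
    (by rw [Finset.card_singleton]; omega) (by
      rw [Finset.card_erase_of_mem (Finset.mem_univ j), Finset.card_univ, Fintype.card_fin]
      omega)
  have hi : i ∈ A := hiA (Finset.mem_singleton_self i)
  have hj : j ∉ A := fun h => by simpa using hAj h
  have := h3 η hη A hA (swap A i j) ((card_swap hi hj).trans hA)
  rw [sum_swap hi hj] at this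
  linarith

/-- A subdivision all of whose octahedra are subdivided refines each of its refinements. -/
theorem Refines.symm_of_subdivided {n k : ℕ} (hk : 0 < k) (hkn : k < n) {P Q : Finset (Fin n) → ℝ}
    (hQP : Refines n k Q P) (hP : IsPosTropPlucker n k P) (hPs : OctahedraSubdivided n k P)
    (hQ : IsPosTropPlucker n k Q) : Refines n k P Q := by
  intro lam₀
  obtain ⟨lam, hsub, hspan⟩ := exists_spanning_minFace hk hkn P lam₀
  obtain ⟨mu, -, ⟨A, hA⟩, hmax⟩ :=
    exists_argminOn_superset (minFace_nonempty hkn.le (tilt P lam)) Q 0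
  have hFspan : IsSpanning (argminOn (minFace k (tilt P lam)) (tilt Q mu)) :=
    fun η hη => hspan η (hmax η hη)
  have comb : ∀ α β : ℝ, 0 ≤ α → 0 ≤ β → 0 < α + β →
      IsTropPlucker n k (α • tilt P lam + β • tilt Q mu) ∧
        NoTie n k (α • tilt P lam + β • tilt Q mu) := by
    intro α β hα hβ hαβ
    have h := hQP.combination hP hPs hQ hα hβ hαβ
    have e : α • tilt P lam + β • tilt Q mu = tilt (α • P + β • Q) (α • lam + β • mu) := by
      ext I
      simp only [tilt, Pi.add_apply, Pi.smul_apply, smul_eq_mul, Finset.sum_add_distrib,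
        ← Finset.mul_sum]
      ring
    rw [e]
    exact ⟨h.1.isTropPlucker.tilt _, h.2.noTie.tilt _⟩
  have hP' := hP.isTropPlucker.tilt lam
  have hPT' := hPs.noTie.tilt lam
  rw [faceOf_eq_minFace]
  simp only [faceOf_eq_minFace]
  generalize tilt P lam = P' at *
  refine ⟨mu, hsub.trans ?_⟩
  generalize tilt Q mu = Q' at *
  have hFG : argminOn (minFace k P') Q' = minFace k P' := by
    obtain ⟨δ, hδ, hsmall⟩ := exists_pos_forall_mul_lt (fun B => P' B - P' A)
      (fun B => Q' A - Q' B)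
    have hmin : ∀ B : Finset (Fin n), B.card = k → B ∉ minFace k P' →
        P' A + δ * Q' A < P' B + δ * Q' B := by
      intro B hB hBG
      have := hsmall B (sub_pos.2 (lt_of_notMem_minFace hA.1 hB hBG))
      linarith
    have hF : minFace k ((1 : ℝ) • P' + δ • Q') = argminOn (minFace k P') Q' := by
      simp only [one_smul]
      ext B
      constructor
      · intro hB
        have h1 := hB.2 A hA.1.1
        simp only [Pi.add_apply, Pi.smul_apply, smul_eq_mul] at h1
        have hBG : B ∈ minFace k P' := by
          by_contra hBG
          exact absurd h1 (not_le.2 (hmin B hB.1 hBG))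
        have h2 : Q' B ≤ Q' A := by
          rw [minFace_eq_of_mem hBG hA.1] at h1
          exact le_of_mul_le_mul_left (by linarith) hδ
        exact ⟨hBG, fun D hD => h2.trans (hA.2 D hD)⟩
      · intro hB
        refine ⟨hB.1.1, fun D hD => ?_⟩
        simp only [Pi.add_apply, Pi.smul_apply, smul_eq_mul]
        rw [argminOn_eq hB hA, minFace_eq_of_mem hB.1 hA.1]
        by_cases hDG : D ∈ minFace k P'
        · have := mul_le_mul_of_nonneg_left (hA.2 D hDG) hδ.le
          rw [minFace_eq_of_mem hDG hA.1]
          linarith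
        · exact (hmin D hD hDG).le
    rw [← hF]
    refine minFace_eq_of_subset hP' hPT' (comb 1 δ zero_le_one hδ.le (by linarith)).1 ?_ ?_ ?_
    · rw [hF]; exact fun B hB => hB.1
    · rw [hF]; exact ⟨A, hA⟩
    · rw [hF]; exact hFspan
  have hconst : ∀ B ∈ minFace k P', Q' B = Q' A := fun B hB => argminOn_eq (hFG.symm.subset hB) hA
  suffices h : ∀ B : Finset (Fin n), B.card = k → Q' A ≤ Q' B from
    fun B hB => ⟨hB.1, fun D hD => (hconst B hB).trans_le (h D hD)⟩
  by_contra! hcon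
  obtain ⟨B, hB, hBA⟩ := hcon
  have hBP : P' A < P' B :=
    lt_of_notMem_minFace hA.1 hB fun h => hBA.ne (hconst B h)
  obtain ⟨C, ⟨hC, hAC⟩, hmaxC⟩ := Set.exists_max_image
    {D : Finset (Fin n) | D.card = k ∧ P' A < P' D} (fun D => (Q' A - Q' D) / (P' D - P' A))
    (Set.toFinite _) ⟨B, hB, hBP⟩
  obtain ⟨N, hN⟩ : ∃ N, N = (Q' A - Q' C) / (P' C - P' A) := ⟨_, rfl⟩
  have hN0 : 0 < N := by
    have h1 := hmaxC B ⟨hB, hBP⟩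
    have h2 : 0 < (Q' A - Q' B) / (P' B - P' A) := div_pos (sub_pos.2 hBA) (sub_pos.2 hBP)
    rw [hN]
    exact h2.trans_le h1
  have hNC : Q' A - Q' C = N * (P' C - P' A) := by
    rw [hN, div_mul_cancel₀ _ (sub_pos.2 hAC).ne']
  have hle : ∀ D : Finset (Fin n), D.card = k → N * P' A + Q' A ≤ N * P' D + Q' D := by
    intro D hD
    by_cases hDG : D ∈ minFace k P'
    · rw [hconst D hDG, minFace_eq_of_mem hDG hA.1]
    · have h1 := lt_of_notMem_minFace hA.1 hD hDG
      have h2 := hmaxC D ⟨hD, h1⟩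
      simp only [← hN] at h2
      rw [div_le_iff₀ (sub_pos.2 h1)] at h2
      linarith
  have hcomb := comb N 1 hN0.le zero_le_one (by linarith)
  rw [one_smul] at hcomb
  have heq := minFace_eq_of_subset hcomb.1 hcomb.2 hP' (fun D hD => ⟨hD.1, fun E hE => by
    simp only [Pi.add_apply, Pi.smul_apply, smul_eq_mul]
    rw [hconst D hD, minFace_eq_of_mem hD hA.1]
    exact hle E hE⟩) ⟨A, hA.1⟩ hspan
  have hCm : C ∈ minFace k (N • P' + Q') := ⟨hC, fun E hE => by
    simp only [Pi.add_apply, Pi.smul_apply, smul_eq_mul]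
    have := hle E hE
    linarith⟩
  rw [← heq] at hCm
  exact hAC.ne' (minFace_eq_of_mem hCm hA.1)

theorem Refines.range_subset {n k : ℕ} (hkn : k ≤ n) {P Q : Finset (Fin n) → ℝ}
    (hQP : Refines n k Q P) (hPQ : Refines n k P Q) :
    Set.range (FaceOf n k Q) ⊆ Set.range (FaceOf n k P) := by
  rintro _ ⟨mu, rfl⟩
  obtain ⟨lam, h1⟩ := hQP mu
  obtain ⟨nu, h2⟩ := hPQ lam
  simp only [Set.mem_range]
  simp only [faceOf_eq_minFace] at *
  obtain ⟨A, hA⟩ := minFace_nonempty hkn (tilt Q mu)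
  have hAP := h1 hA
  have hη : ∀ B ∈ minFace k (tilt P lam), ∑ i ∈ A, (mu i - nu i) - ∑ i ∈ B, (mu i - nu i) =
      tilt Q mu B - tilt Q mu A := by
    intro B hB
    have := minFace_eq_of_mem (h2 hAP) (h2 hB)
    simp only [tilt, Finset.sum_sub_distrib] at this ⊢
    linarith
  obtain ⟨δ, hδ, hsmall⟩ := exists_pos_forall_mul_lt (fun B => tilt P lam B - tilt P lam A)
    (fun B => ∑ i ∈ B, (mu i - nu i) - ∑ i ∈ A, (mu i - nu i))
  have htilt : ∀ B, tilt P (lam + δ • (mu - nu)) B =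
      tilt P lam B - δ * ∑ i ∈ B, (mu i - nu i) := by
    intro B
    simp only [tilt, Pi.add_apply, Pi.smul_apply, Pi.sub_apply, smul_eq_mul,
      Finset.sum_add_distrib, ← Finset.mul_sum]
    ring
  have hout : ∀ B : Finset (Fin n), B.card = k → B ∉ minFace k (tilt P lam) →
      tilt P (lam + δ • (mu - nu)) A < tilt P (lam + δ • (mu - nu)) B := by
    intro B hB hBP
    have := hsmall B (sub_pos.2 (lt_of_notMem_minFace hAP hB hBP))
    rw [htilt, htilt]
    linarith
  refine ⟨lam + δ • (mu - nu), Set.Subset.antisymm (fun B hB => ?_) fun B hB => ?_⟩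
  · have h3 := hB.2 A hA.1
    have hBP : B ∈ minFace k (tilt P lam) := by
      by_contra hBP
      exact absurd h3 (not_le.2 (hout B hB.1 hBP))
    rw [htilt, htilt, minFace_eq_of_mem hBP hAP] at h3
    have h4 := hη B hBP
    refine mem_minFace_of_le hA hB.1 ?_
    have : ∑ i ∈ A, (mu i - nu i) ≤ ∑ i ∈ B, (mu i - nu i) :=
      le_of_mul_le_mul_left (by linarith) hδ
    linarith
  · refine ⟨hB.1, fun D hD => ?_⟩
    have hBP := h1 hB
    have h4 := hη B hBP
    have e : tilt P (lam + δ • (mu - nu)) B = tilt P (lam + δ • (mu - nu)) A := by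
      have : ∑ i ∈ A, (mu i - nu i) = ∑ i ∈ B, (mu i - nu i) := by
        rw [minFace_eq_of_mem hB hA] at h4
        linarith
      rw [htilt, htilt, minFace_eq_of_mem hBP hAP, this]
    rw [e]
    by_cases hDP : D ∈ minFace k (tilt P lam)
    · rw [htilt, htilt, minFace_eq_of_mem hDP hAP]
      have h5 := hη D hDP
      have h6 := hA.2 D hD
      have := mul_le_mul_of_nonneg_left
        (show ∑ i ∈ D, (mu i - nu i) ≤ ∑ i ∈ A, (mu i - nu i) by linarith) hδ.le
      linarith
    · exact (hout D hD hDP).le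

theorem OctahedraSubdivided.isFinest {n k : ℕ} (hk : 0 < k) (hkn : k < n)
    {P : Finset (Fin n) → ℝ} (hP : IsPosTropPlucker n k P) (hPs : OctahedraSubdivided n k P) :
    IsFinest n k P := by
  intro Q hQ hQP
  have hPQ := hQP.symm_of_subdivided hk hkn hP hPs hQ
  exact (hQP.range_subset hkn.le hPQ).antisymm (hPQ.range_subset hkn.le hQP)

/-- A spanning set which is contained in faces of `Q i` for `i` along a filter is contained in a
face of the limit of the `Q i`. -/
theorem exists_subset_minFace_of_tendsto {n k : ℕ} (hn : 0 < n) {ι : Type*} {l : Filter ι} [l.NeBot]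
    {Q : ι → Finset (Fin n) → ℝ} {P : Finset (Fin n) → ℝ}
    (hQ : ∀ I : Finset (Fin n), I.card = k → Filter.Tendsto (fun i => Q i I) l (nhds (P I)))
    {F : Set (Finset (Fin n))} (hne : F.Nonempty) (hF : IsSpanning F)
    (h : ∀ᶠ i in l, ∃ mu, F ⊆ minFace k (tilt (Q i) mu)) :
    ∃ lam, F ⊆ minFace k (tilt P lam) := by
  classical
  obtain ⟨A₀, hA₀⟩ := hne
  let i₀ : Fin n := ⟨0, hn⟩
  let M : (Fin n → ℝ) →ₗ[ℝ] (F → ℝ) × ℝ :=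
    { toFun := fun η => (fun A => ∑ i ∈ A.1, η i - ∑ i ∈ A₀, η i, η i₀)
      map_add' := fun η θ => by
        ext A
        · simp only [Pi.add_apply, Finset.sum_add_distrib, Prod.mk_add_mk]; ring
        · rfl
      map_smul' := fun c η => by
        ext A
        · simp only [Pi.smul_apply, smul_eq_mul, ← Finset.mul_sum, RingHom.id_apply,
            Prod.smul_mk]; ring
        · rfl }
  have hM : LinearMap.ker M = ⊥ := by
    rw [LinearMap.ker_eq_bot']
    intro η hη
    have h1 : (fun A : F => ∑ i ∈ A.1, η i - ∑ i ∈ A₀, η i) = 0 := congrArg Prod.fst hη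
    have h2 : η i₀ = 0 := congrArg Prod.snd hη
    have h3 : ∀ A ∈ F, ∑ i ∈ A, η i = ∑ i ∈ A₀, η i := fun A hA =>
      sub_eq_zero.1 (congrFun h1 ⟨A, hA⟩)
    ext j
    exact (hF η (fun A hA B hB => (h3 A hA).trans (h3 B hB).symm) j i₀).trans h2
  obtain ⟨g, hg⟩ := M.exists_leftInverse_of_injective hM
  have hgc : Continuous g := g.continuous_of_finiteDimensional
  have hcard : ∀ A ∈ F, A.card = k := by
    obtain ⟨i, mu, hmu⟩ := h.exists
    exact fun A hA => (hmu hA).1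
  let L : ι → Fin n → ℝ := fun i => g (fun A => Q i A.1 - Q i A₀, 0)
  have hL : Filter.Tendsto L l (nhds (g (fun A => P A.1 - P A₀, 0))) := by
    refine (hgc.tendsto _).comp (Filter.Tendsto.prodMk_nhds ?_ tendsto_const_nhds)
    exact tendsto_pi_nhds.2 fun A => (hQ _ (hcard _ A.2)).sub (hQ _ (hcard _ hA₀))
  have htilt : ∀ I : Finset (Fin n), I.card = k → Filter.Tendsto (fun i => tilt (Q i) (L i) I) l
      (nhds (tilt P (g (fun A => P A.1 - P A₀, 0)) I)) := fun I hI =>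
    (hQ I hI).sub (tendsto_finsetSum _ fun j _ => (tendsto_pi_nhds.1 hL) j)
  refine ⟨g (fun A => P A.1 - P A₀, 0), fun A hA => ⟨hcard A hA, fun B hB => ?_⟩⟩
  refine le_of_tendsto_of_tendsto (htilt A (hcard A hA)) (htilt B hB) ?_
  filter_upwards [h] with i hi
  obtain ⟨mu, hmu⟩ := hi
  have hLi : L i = mu - fun _ => mu i₀ := by
    have e : (fun A : F => Q i A.1 - Q i A₀, (0 : ℝ)) = M (mu - fun _ => mu i₀) := by
      refine Prod.ext (funext fun A => ?_) (by simp [M])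
      have h1 := minFace_eq_of_mem (hmu A.2) (hmu hA₀)
      simp only [tilt] at h1
      simp only [M, LinearMap.coe_mk, AddHom.coe_mk, Pi.sub_apply, Finset.sum_sub_distrib,
        Finset.sum_const, hcard _ A.2, hcard _ hA₀]
      linarith
    change g _ = _
    rw [e]
    exact LinearMap.congr_fun hg _
  have := (hmu hA).2 B hB
  simp only [hLi, tilt, Pi.sub_apply, Finset.sum_sub_distrib, Finset.sum_const, hcard A hA,
    hB] at this ⊢
  linarith

theorem exists_refines_of_tendsto {n k : ℕ} (hk : 0 < k) (hkn : k < n)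
    {Q : ℕ → Finset (Fin n) → ℝ} {P : Finset (Fin n) → ℝ}
    (hQ : ∀ I : Finset (Fin n), I.card = k →
      Filter.Tendsto (fun i => Q i I) Filter.atTop (nhds (P I))) :
    ∃ i, Refines n k (Q i) P := by
  have key : ∀ F : Set (Finset (Fin n)), F.Nonempty → IsSpanning F → ∀ᶠ i in Filter.atTop,
      (∃ mu, F ⊆ minFace k (tilt (Q i) mu)) → ∃ lam, F ⊆ minFace k (tilt P lam) := by
    intro F hne hF
    by_contra hcon
    rw [Filter.not_eventually] at hcon
    have : (Filter.atTop ⊓ Filter.principal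
        {i | ∃ mu, F ⊆ minFace k (tilt (Q i) mu)}).NeBot := by
      rw [← Filter.frequently_mem_iff_neBot]
      exact hcon.mono fun i hi => (Classical.not_imp.1 hi).1
    obtain ⟨i, hi⟩ := hcon.exists
    exact hi fun _ => exists_subset_minFace_of_tendsto (by omega)
      (fun I hI => (hQ I hI).mono_left inf_le_left) hne hF
      (Filter.mem_inf_of_right (Filter.mem_principal_self _))
  obtain ⟨i, hi⟩ := (Filter.eventually_all.2 fun F : Set (Finset (Fin n)) =>
    Filter.eventually_imp_distrib_left.2 fun h1 : F.Nonempty =>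
      Filter.eventually_imp_distrib_left.2 fun h2 : IsSpanning F => key F h1 h2).exists
  refine ⟨i, fun nu => ?_⟩
  obtain ⟨mu, h1, h2⟩ := exists_spanning_minFace hk hkn (Q i) nu
  obtain ⟨lam, h3⟩ := hi _ (minFace_nonempty hkn.le _) h2 ⟨mu, subset_rfl⟩
  exact ⟨lam, by rw [faceOf_eq_minFace, faceOf_eq_minFace]; exact h1.trans h3⟩

theorem IsFinest.octahedraSubdivided {n k : ℕ} {P Q : Finset (Fin n) → ℝ} (hf : IsFinest n k P)
    (hP : IsPosTropPlucker n k P) (hQ : IsPosTropPlucker n k Q) (hQs : OctahedraSubdivided n k Q)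
    (hQP : Refines n k Q P) : OctahedraSubdivided n k P := by
  have hPQ : Refines n k P Q := fun lam => by
    obtain ⟨mu, hmu⟩ : FaceOf n k P lam ∈ Set.range (FaceOf n k Q) := by
      rw [hf Q hQ hQP]; exact ⟨lam, rfl⟩
    exact ⟨mu, hmu.ge⟩
  intro S hS a b c d hab hbc hcd ha hb hc hd htie
  obtain ⟨r1, r2⟩ := hPQ.sorted_eq hP.isTropPlucker hS hab hbc hcd ha hb hc hd
  have hp : P (S ∪ {a, c}) + P (S ∪ {b, d}) = P (S ∪ {a, b}) + P (S ∪ {c, d}) := by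
    rcases hP S hS a b c d hab hbc hcd ha hb hc hd with ⟨h, _⟩ | ⟨h, _⟩
    · exact h
    · exact h.trans htie.symm
  exact hQs S hS a b c d hab hbc hcd ha hb hc hd
    ((r1 hp htie.le).symm.trans (r2 (hp.trans htie) htie.ge))

/-- The maximal minor, with rows indexed by `I`, of the matrix whose rows are `v 0, v 1, …`. -/
noncomputable def minor {k : ℕ} (v : ℕ → Fin k → ℝ) (I : Finset ℕ) : ℝ :=
  if h : I.card = k then Matrix.det (Matrix.of fun i => v (I.orderEmbOfFin h i)) else 0

theorem minor_eq_det {k : ℕ} (v : ℕ → Fin k → ℝ) {I : Finset ℕ} (h : I.card = k) {f : Fin k → ℕ}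
    (hf : StrictMono f) (hI : ∀ i, f i ∈ I) :
    minor v I = Matrix.det (Matrix.of fun i => v (f i)) := by
  rw [minor, dif_pos h, Finset.orderEmbOfFin_unique h hI hf]

theorem minor_eq_det_orderEmbOfFin {k : ℕ} (v : ℕ → Fin k → ℝ) {I : Finset ℕ} (h : I.card = k) :
    minor v I = Matrix.det (Matrix.of fun i => v (I.orderEmbOfFin h i)) := by
  rw [minor, dif_pos h]

/-- The sign relating a minor to a determinant with permuted rows is the sign of the Vandermonde
determinant of the row indices. -/
theorem minor_mul_vandermonde {k : ℕ} (v : ℕ → Fin k → ℝ) {I : Finset ℕ} (h : I.card = k)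
    {g : Fin k → ℕ} (hg : Function.Injective g) (hI : ∀ i, g i ∈ I) :
    minor v I * (Matrix.vandermonde fun i => (g i : ℝ)).det =
      Matrix.det (Matrix.of fun i => v (g i)) * |(Matrix.vandermonde fun i => (g i : ℝ)).det| := by
  let e := I.orderIsoOfFin h
  have hσ : Function.Injective fun i => e.symm ⟨g i, hI i⟩ := by
    intro i j hij
    have := e.symm.injective hij
    exact hg (Subtype.ext_iff.1 this)
  let σ : Equiv.Perm (Fin k) := Equiv.ofBijective _ (Finite.injective_iff_bijective.1 hσ)
  have hgσ : ∀ i, g i = I.orderEmbOfFin h (σ i) := by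
    intro i
    have : e (σ i) = ⟨g i, hI i⟩ := e.apply_symm_apply _
    rw [← Finset.coe_orderIsoOfFin_apply]
    exact (congrArg Subtype.val this).symm
  have h1 : Matrix.det (Matrix.of fun i => v (g i)) =
      (Equiv.Perm.sign σ : ℤ) * minor v I := by
    rw [minor_eq_det_orderEmbOfFin v h, ← Matrix.det_permute σ]
    congr 1
    ext i j
    simp [hgσ]
  have h2 : (Matrix.vandermonde fun i => (g i : ℝ)).det =
      (Equiv.Perm.sign σ : ℤ) *
        (Matrix.vandermonde fun i => (I.orderEmbOfFin h i : ℝ)).det := by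
    rw [← Matrix.det_permute σ]
    congr 1
    ext i j
    simp [hgσ, Matrix.vandermonde_apply]
  have h3 : 0 < (Matrix.vandermonde fun i => (I.orderEmbOfFin h i : ℝ)).det := by
    rw [Matrix.det_vandermonde]
    refine Finset.prod_pos fun i _ => Finset.prod_pos fun j hj => sub_pos.2 ?_
    exact Nat.cast_lt.2 ((I.orderEmbOfFin h).strictMono (Finset.mem_Ioi.1 hj))
  rw [h1, h2, abs_mul, abs_of_pos h3]
  rcases Int.units_eq_one_or (Equiv.Perm.sign σ) with h | h <;> simp [h]

theorem vandermonde_cons_cons {p : ℕ} (x y : ℝ) (e : Fin p → ℝ) :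
    (Matrix.vandermonde (Fin.cons x (Fin.cons y e) : Fin (p + 2) → ℝ)).det =
      (y - x) * ((∏ i, (e i - x)) * (∏ i, (e i - y)) * (Matrix.vandermonde e).det) := by
  simp only [Matrix.det_vandermonde, Fin.prod_univ_succ, Fin.Ioi_zero_eq_map, Fin.Ioi_succ,
    Finset.prod_map, Fin.cons_zero, Fin.cons_succ, Fin.coe_succEmb]
  ring

/-- The determinants with all but two rows fixed satisfy the three-term Plücker relation. -/
theorem det_cons_cons_plucker {p : ℕ} (s : Fin p → Fin (p + 2) → ℝ) (a b c d : Fin (p + 2) → ℝ) :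
    let φ : (Fin (p + 2) → ℝ) → (Fin (p + 2) → ℝ) → ℝ := fun x y =>
      Matrix.det (Matrix.of (Fin.cons x (Fin.cons y s) : Fin (p + 2) → Fin (p + 2) → ℝ))
    φ a c * φ b d = φ a b * φ c d + φ a d * φ b c := by
  intro φ
  let M : Matrix (Fin (p + 2)) (Fin (p + 2)) ℝ := Matrix.of (Fin.cons a (Fin.cons c s))
  have h0 : M.updateRow 0 b = Matrix.of (Fin.cons b (Fin.cons c s)) := by
    ext i j
    refine Fin.cases ?_ (fun i => ?_) i
    · simp
    · simp [M, Matrix.updateRow_apply]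
  have h1 : M.updateRow 1 b = Matrix.of (Fin.cons a (Fin.cons b s)) := by
    ext i j
    refine Fin.cases ?_ (fun i => ?_) i
    · simp [M, Matrix.updateRow_apply]
    · refine Fin.cases ?_ (fun i => ?_) i
      · simp [Matrix.updateRow_apply]
      · simp [M, Matrix.updateRow_apply, Fin.ext_iff]
  have hc := Matrix.mulVec_cramer M.transpose b
  rw [Matrix.det_transpose] at hc
  have hsum : M.det • b = ∑ i, (M.updateRow i b).det • M i := by
    rw [← hc]
    ext j
    simp [Matrix.mulVec, dotProduct, Matrix.cramer_transpose_apply, Finset.sum_apply, mul_comm]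
  let N : Matrix (Fin (p + 2)) (Fin (p + 2)) ℝ := Matrix.of (Fin.cons 0 (Fin.cons d s))
  have hL : ∀ x, φ x d = (N.updateRow 0 x).det := by
    intro x
    change Matrix.det _ = _
    congr 1
    ext i j
    refine Fin.cases ?_ (fun i => ?_) i
    · simp
    · simp [N, Matrix.updateRow_apply]
  let L : (Fin (p + 2) → ℝ) →ₗ[ℝ] ℝ :=
    { toFun := fun x => (N.updateRow 0 x).det
      map_add' := fun x y => Matrix.det_updateRow_add N 0 x y
      map_smul' := fun t x => Matrix.det_updateRow_smul N 0 t x }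
  have hLφ : ∀ x, L x = φ x d := fun x => (hL x).symm
  have hLs : ∀ i : Fin p, L (s i) = 0 := by
    intro i
    rw [hLφ]
    refine Matrix.det_zero_of_row_eq (i := 0) (j := i.succ.succ) (Fin.succ_ne_zero _).symm ?_
    ext j
    simp
  have h := congrArg L hsum
  rw [map_smul, map_sum, Fin.sum_univ_succ, Fin.sum_univ_succ] at h
  simp only [map_smul, Fin.succ_zero_eq_one, h0, h1] at h
  have e0 : M 0 = a := rfl
  have e1 : M 1 = c := rfl
  have e2 : ∀ i : Fin p, M i.succ.succ = s i := fun i => rfl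
  simp only [e0, e1, e2, hLs, hLφ, smul_eq_mul, mul_zero, Finset.sum_const_zero, add_zero] at h
  change φ a c * φ b d = φ b c * φ a d + φ a b * φ c d at h
  linarith

theorem minor_plucker {k : ℕ} (v : ℕ → Fin k → ℝ) {S : Finset ℕ} (hS : S.card + 2 = k)
    {a b c d : ℕ} (hab : a < b) (hbc : b < c) (hcd : c < d) (ha : a ∉ S) (hb : b ∉ S) (hc : c ∉ S)
    (hd : d ∉ S) :
    minor v (insert a (insert c S)) * minor v (insert b (insert d S)) =
      minor v (insert a (insert b S)) * minor v (insert c (insert d S)) +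
        minor v (insert a (insert d S)) * minor v (insert b (insert c S)) := by
  subst hS
  let e : Fin S.card → ℕ := S.orderEmbOfFin rfl
  have he : ∀ i, e i ∈ S := fun i => S.orderEmbOfFin_mem rfl i
  let p : ℕ → ℝ := fun x => ∏ i, ((e i : ℝ) - x)
  let V : ℝ := (Matrix.vandermonde fun i => (e i : ℝ)).det
  let φ : ℕ → ℕ → ℝ := fun x y =>
    Matrix.det (Matrix.of (Fin.cons (v x) (Fin.cons (v y) fun i => v (e i)) :
      Fin (S.card + 2) → Fin (S.card + 2) → ℝ))
  have hp : ∀ x ∉ S, p x ≠ 0 := fun x hx => Finset.prod_ne_zero_iff.2 fun i _ h =>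
    hx (Nat.cast_injective (R := ℝ) (sub_eq_zero.1 h) ▸ he i)
  have hV : V ≠ 0 := Matrix.det_vandermonde_ne_zero_iff.2
    (Nat.cast_injective.comp (S.orderEmbOfFin rfl).injective)
  have key : ∀ x y, x < y → x ∉ S → y ∉ S →
      minor v (insert x (insert y S)) * (p x * p y * V) = φ x y * |p x * p y * V| := by
    intro x y hxy hx hy
    have hxS : x ∉ insert y S := by simp [hx, hxy.ne]
    let g : Fin (S.card + 2) → ℕ := Fin.cons x (Fin.cons y e)
    have hg : Function.Injective g := by
      refine Fin.cons_injective_iff.2 ⟨?_, Fin.cons_injective_iff.2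
        ⟨?_, (S.orderEmbOfFin rfl).injective⟩⟩
      · rintro ⟨i, hi⟩
        refine hxS ?_
        rw [← hi]
        refine Fin.cases ?_ (fun i => ?_) i
        · simp
        · simp [he]
      · rintro ⟨i, hi⟩
        exact hy (hi ▸ he i)
    have h := minor_mul_vandermonde v (I := insert x (insert y S)) (k := S.card + 2)
      (by rw [Finset.card_insert_of_notMem hxS, Finset.card_insert_of_notMem hy]) hg (by
        intro i
        refine Fin.cases ?_ (fun i => ?_) i
        · simp [g]
        · refine Fin.cases ?_ (fun i => ?_) i
          · simp [g]
          · simp [g, he])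
    have e1 : (fun i => (g i : ℝ)) = Fin.cons (x : ℝ) (Fin.cons (y : ℝ) fun i => (e i : ℝ)) := by
      ext i
      refine Fin.cases rfl (fun i => ?_) i
      exact Fin.cases rfl (fun i => rfl) i
    have e2 : (Matrix.of fun i => v (g i)) =
        Matrix.of (Fin.cons (v x) (Fin.cons (v y) fun i => v (e i))) := by
      ext i j
      refine Fin.cases rfl (fun i => ?_) i
      exact Fin.cases rfl (fun i => rfl) i
    have hxy' : (0 : ℝ) < (y : ℝ) - x := sub_pos.2 (Nat.cast_lt.2 hxy)
    rw [e1, e2, vandermonde_cons_cons, abs_mul, abs_of_pos hxy'] at h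
    refine mul_left_cancel₀ hxy'.ne' ?_
    change minor v (insert x (insert y S)) * (((y : ℝ) - x) * (p x * p y * V)) =
      φ x y * (((y : ℝ) - x) * |p x * p y * V|) at h
    linarith
  have hφ : φ a c * φ b d = φ a b * φ c d + φ a d * φ b c :=
    det_cons_cons_plucker (fun i => v (e i)) (v a) (v b) (v c) (v d)
  have kac := key a c (hab.trans hbc) ha hc
  have kbd := key b d (hbc.trans hcd) hb hd
  have kab := key a b hab ha hb
  have kcd := key c d hcd hc hd
  have kad := key a d (hab.trans (hbc.trans hcd)) ha hd
  have kbc := key b c hbc hb hc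
  have hZ : p a * p b * p c * p d * V * V ≠ 0 :=
    mul_ne_zero (mul_ne_zero (mul_ne_zero (mul_ne_zero (mul_ne_zero (hp a ha) (hp b hb))
      (hp c hc)) (hp d hd)) hV) hV
  refine mul_right_cancel₀ hZ ?_
  have m := congrArg₂ (· * ·) kac kbd
  have m1 := congrArg₂ (· * ·) kab kcd
  have m2 := congrArg₂ (· * ·) kad kbc
  simp only [abs_mul] at m m1 m2
  linear_combination m - m1 - m2 + |p a| * |p b| * |p c| * |p d| * |V| * |V| * hφ

/-- The effect on minors of adding a multiple of row `j` to row `j + 1`. -/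
theorem minor_update_of_mem {k : ℕ} (v : ℕ → Fin k → ℝ) (w : ℝ) {I : Finset ℕ} (h : I.card = k)
    {j : ℕ} (hj1 : j + 1 ∈ I) (hj : j ∉ I) :
    minor (Function.update v (j + 1) (v (j + 1) + w • v j)) I =
      minor v I + w * minor v (insert j (I.erase (j + 1))) := by
  obtain ⟨q, hq⟩ : ∃ q, I.orderEmbOfFin h q = j + 1 := by
    have : j + 1 ∈ Set.range (I.orderEmbOfFin h) := by
      rw [Finset.range_orderEmbOfFin]; exact hj1
    exact this
  have hf := (I.orderEmbOfFin h).strictMono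
  have hmem := I.orderEmbOfFin_mem h
  have hjr : ∀ i, I.orderEmbOfFin h i ≠ j := fun i hi => hj (hi ▸ hmem i)
  generalize hfe : (⇑(I.orderEmbOfFin h) : Fin k → ℕ) = f at *
  have hg : StrictMono (Function.update f q j) := by
    intro x y hxy
    simp only [Function.update_apply]
    split_ifs with h1 h2 h2
    · exact absurd (h1.trans h2.symm) hxy.ne
    · subst h1
      have := hf hxy
      omega
    · subst h2
      have := hf hxy
      have := hjr x
      omega
    · exact hf hxy
  have hgm : ∀ i, Function.update f q j i ∈ insert j (I.erase (j + 1)) := by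
    intro i
    simp only [Function.update_apply]
    split_ifs with h1
    · simp
    · refine Finset.mem_insert_of_mem (Finset.mem_erase.2 ⟨fun hi => h1 (hf.injective ?_), hmem i⟩)
      rw [hi, hq]
  have hcard : (insert j (I.erase (j + 1))).card = k := by
    rw [Finset.card_insert_of_notMem (by simp [hj]), Finset.card_erase_add_one hj1, h]
  rw [minor_eq_det v h hf hmem, minor_eq_det v hcard hg hgm, minor_eq_det _ h hf hmem]
  have e1 : (Matrix.of fun i => Function.update v (j + 1) (v (j + 1) + w • v j) (f i)) =
      (Matrix.of fun i => v (f i)).updateRow q (v (j + 1) + w • v j) := by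
    ext i l
    by_cases hi : i = q
    · subst hi
      simp [hq]
    · have : f i ≠ j + 1 := fun h => hi (hf.injective (h.trans hq.symm))
      simp [hi, this]
  have e2 : (Matrix.of fun i => v (f i)).updateRow q (v (j + 1)) = Matrix.of fun i => v (f i) := by
    rw [← hq]
    exact Matrix.updateRow_eq_self _ q
  have e3 : (Matrix.of fun i => v (f i)).updateRow q (v j) =
      Matrix.of fun i => v (Function.update f q j i) := by
    ext i l
    by_cases hi : i = q
    · subst hi; simp
    · simp [hi]
  rw [e1, Matrix.det_updateRow_add, Matrix.det_updateRow_smul, e2, e3]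

theorem minor_update_of_not {k : ℕ} (v : ℕ → Fin k → ℝ) (w : ℝ) {I : Finset ℕ} (h : I.card = k)
    {j : ℕ} (hj : ¬ (j + 1 ∈ I ∧ j ∉ I)) :
    minor (Function.update v (j + 1) (v (j + 1) + w • v j)) I = minor v I := by
  have hf := (I.orderEmbOfFin h).strictMono
  have hmem := I.orderEmbOfFin_mem h
  have hr := I.range_orderEmbOfFin h
  generalize hfe : (⇑(I.orderEmbOfFin h) : Fin k → ℕ) = f at *
  rw [minor_eq_det _ h hf hmem, minor_eq_det _ h hf hmem]
  by_cases hj1 : j + 1 ∈ I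
  · have hjI : j ∈ I := by tauto
    obtain ⟨q, hq⟩ : j + 1 ∈ Set.range f := by rw [hr]; exact hj1
    obtain ⟨q', hq'⟩ : j ∈ Set.range f := by rw [hr]; exact hjI
    have hqq : q ≠ q' := fun h => by
      subst h
      omega
    have e1 : (Matrix.of fun i => Function.update v (j + 1) (v (j + 1) + w • v j) (f i)) =
        (Matrix.of fun i => v (f i)).updateRow q
          ((Matrix.of fun i => v (f i)) q + w • (Matrix.of fun i => v (f i)) q') := by
      ext i l
      by_cases hi : i = q
      · subst hi
        simp [hq, hq']
      · have : f i ≠ j + 1 := fun h => hi (hf.injective (h.trans hq.symm))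
        simp [hi, this]
    rw [e1, Matrix.det_updateRow_add_smul_self _ hqq]
  · congr 1
    ext i l
    have : f i ≠ j + 1 := fun h => hj1 (h ▸ hmem i)
    simp [this]

/-- Add a new first row, and a new first column which vanishes on the other rows. -/
def extend {k : ℕ} (u : ℕ → Fin k → ℝ) : ℕ → Fin (k + 1) → ℝ
  | 0 => Fin.cons 1 0
  | i + 1 => Fin.cons 0 (u i)

theorem minor_extend_of_notMem {k : ℕ} (u : ℕ → Fin k → ℝ) {I : Finset ℕ} (h0 : 0 ∉ I) :
    minor (extend u) I = 0 := by
  by_cases h : I.card = k + 1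
  · rw [minor_eq_det_orderEmbOfFin _ h]
    refine Matrix.det_eq_zero_of_column_eq_zero 0 fun i => ?_
    have := I.orderEmbOfFin_mem h i
    obtain ⟨q, hq⟩ : ∃ q, I.orderEmbOfFin h i = q + 1 :=
      Nat.exists_eq_succ_of_ne_zero fun h' => h0 (h' ▸ this)
    simp [hq, extend]
  · rw [minor, dif_neg h]

theorem minor_extend {k : ℕ} (u : ℕ → Fin k → ℝ) {K : Finset ℕ} (h : K.card = k) :
    minor (extend u) (insert 0 (K.image (· + 1))) = minor u K := by
  let f : Fin (k + 1) → ℕ := Fin.cons 0 fun i => K.orderEmbOfFin h i + 1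
  have hf : StrictMono f := by
    intro x y
    refine Fin.cases ?_ (fun x => ?_) x <;> refine Fin.cases ?_ (fun y => ?_) y
    · simp
    · simp [f]
    · simp
    · simp [f]
  have hm : ∀ i, f i ∈ insert 0 (K.image (· + 1)) := by
    intro i
    refine Fin.cases ?_ (fun i => ?_) i
    · simp [f]
    · simp [f, K.orderEmbOfFin_mem h i]
  have hc : (insert 0 (K.image (· + 1))).card = k + 1 := by
    rw [Finset.card_insert_of_notMem (by simp), Finset.card_image_of_injective _
      (add_left_injective 1), h]
  rw [minor_eq_det _ hc hf hm, minor_eq_det_orderEmbOfFin u h, Matrix.det_succ_column_zero,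
    Fin.sum_univ_succ]
  simp only [f, extend, Matrix.of_apply, Fin.cons_zero, Fin.cons_succ, Fin.val_zero, pow_zero,
    one_mul, mul_zero, zero_mul, Finset.sum_const_zero, add_zero]
  congr 1

/-- `T` is the vector of exponential decay rates of the maximal minors, with leading coefficients
equal to one, of a family of matrices with rows indexed by `0, …, N - 1`. -/
def IsRealizable (k N : ℕ) (T : Finset ℕ → ℝ) : Prop :=
  ∃ v : ℝ → ℕ → Fin k → ℝ, ∀ I : Finset ℕ, I.card = k → I ⊆ Finset.range N →
    Filter.Tendsto (fun r => minor (v r) I * Real.exp (r * T I)) Filter.atTop (nhds 1)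

theorem tendsto_exp_mul_of_neg {x : ℝ} (hx : x < 0) :
    Filter.Tendsto (fun r : ℝ => Real.exp (r * x)) Filter.atTop (nhds 0) :=
  Real.tendsto_exp_atBot.comp (Filter.tendsto_id.atTop_mul_const_of_neg hx)

theorem tendsto_add_mul_exp_min {A B : ℝ → ℝ} {x y t : ℝ}
    (hA : Filter.Tendsto (fun r => A r * Real.exp (r * x)) Filter.atTop (nhds 1))
    (hB : Filter.Tendsto (fun r => B r * Real.exp (r * y)) Filter.atTop (nhds 1))
    (hne : x ≠ t + y) :
    Filter.Tendsto (fun r => (A r + Real.exp (-(r * t)) * B r) * Real.exp (r * min x (t + y)))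
      Filter.atTop (nhds 1) := by
  rcases hne.lt_or_gt with h | h
  · have := hA.add (hB.mul (tendsto_exp_mul_of_neg (show x - (t + y) < 0 by linarith)))
    rw [mul_zero, add_zero] at this
    refine this.congr fun r => ?_
    rw [min_eq_left h.le, mul_assoc (B r), ← Real.exp_add, add_mul, mul_comm (Real.exp _) (B r),
      mul_assoc (B r), ← Real.exp_add]
    ring_nf
  · have := (hA.mul (tendsto_exp_mul_of_neg (show t + y - x < 0 by linarith))).add hB
    rw [mul_zero, zero_add] at this
    refine this.congr fun r => ?_
    rw [min_eq_right h.le, mul_assoc (A r), ← Real.exp_add, add_mul, mul_comm (Real.exp _) (B r),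
      mul_assoc (B r), ← Real.exp_add]
    ring_nf

/-- The state after adding multiples of the rows `0, …, j - 1` to the next ones. -/
structure Stage (k N j : ℕ) (T₀ T : Finset ℕ → ℝ) (Ω : ℕ → ℝ) (v : ℝ → ℕ → Fin (k + 1) → ℝ) :
    Prop where
  tendsto : ∀ I : Finset ℕ, I.card = k + 1 → I ⊆ Finset.range N → (∃ i ∈ I, i ≤ j) →
    Filter.Tendsto (fun r => minor (v r) I * Real.exp (r * T I)) Filter.atTop (nhds 1)
  eq_zero : ∀ I : Finset ℕ, I.card = k + 1 → (¬ ∃ i ∈ I, i ≤ j) → ∀ r, minor (v r) I = 0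
  track : ∀ b ≤ j, ∀ K : Finset ℕ, K.card = k → (∀ x ∈ K, b ≤ x) →
    (∀ x ∈ K, x + 1 ≤ j → x ∈ insert b (K.image (· + 1))) →
    T (insert b (K.image (· + 1))) = Ω b + T₀ K

theorem image_succ_image_pred {I : Finset ℕ} (h : 0 ∈ I) :
    insert 0 (((I.erase 0).image Nat.pred).image (· + 1)) = I := by
  ext x
  simp only [Finset.mem_insert, Finset.mem_image, Finset.mem_erase]
  constructor
  · rintro (rfl | ⟨_, ⟨y, ⟨hy0, hy⟩, rfl⟩, rfl⟩)
    · exact h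
    · rwa [← Nat.succ_pred hy0] at hy
  · intro hx
    rcases Nat.eq_zero_or_pos x with h0 | h0
    · exact Or.inl h0
    · exact Or.inr ⟨x - 1, ⟨x, ⟨h0.ne', hx⟩, rfl⟩, by omega⟩

theorem image_pred_image_succ (K : Finset ℕ) :
    ((insert 0 (K.image (· + 1))).erase 0).image Nat.pred = K := by
  rw [Finset.erase_insert (by simp), Finset.image_image]
  exact (Finset.image_congr (fun x _ => by simp)).trans Finset.image_id

theorem stage_zero {k N : ℕ} {T₀ : Finset ℕ → ℝ} (h : IsRealizable k N T₀) :
    ∃ (T : Finset ℕ → ℝ) (v : ℝ → ℕ → Fin (k + 1) → ℝ), Stage k (N + 1) 0 T₀ T 0 v := by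
  obtain ⟨u, hu⟩ := h
  refine ⟨fun I => T₀ ((I.erase 0).image Nat.pred), fun r => extend (u r), ?_, ?_, ?_⟩
  · rintro I hI hIN ⟨i, hi, hi0⟩
    obtain rfl : i = 0 := by omega
    obtain ⟨K, hK⟩ : ∃ K, K = (I.erase 0).image Nat.pred := ⟨_, rfl⟩
    have hIK : insert 0 (K.image (· + 1)) = I := by rw [hK, image_succ_image_pred hi]
    have hcard : K.card = k := by
      rw [← hIK, Finset.card_insert_of_notMem (by simp), Finset.card_image_of_injective _
        (add_left_injective 1)] at hI
      omega
    rw [← hK]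
    have hm : ∀ r, minor (extend (u r)) I = minor (u r) K := fun r => by
      rw [← hIK, minor_extend _ hcard]
    simp only [hm]
    refine hu K hcard fun x hx => ?_
    have : x + 1 ∈ I := by
      rw [← hIK]
      exact Finset.mem_insert_of_mem (Finset.mem_image_of_mem _ hx)
    have := Finset.mem_range.1 (hIN this)
    exact Finset.mem_range.2 (by omega)
  · intro I _ hI r
    exact minor_extend_of_notMem _ fun h => hI ⟨0, h, le_rfl⟩
  · intro b hb K _ _ _
    obtain rfl : b = 0 := by omega
    simp only [image_pred_image_succ, Pi.zero_apply, zero_add]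

theorem Stage.succ {k N j : ℕ} {T₀ T : Finset ℕ → ℝ} {Ω : ℕ → ℝ} {v : ℝ → ℕ → Fin (k + 1) → ℝ}
    (hs : Stage k N j T₀ T Ω v) {t : ℝ}
    (ht : ∀ I ⊆ Finset.range N, ∀ I' ⊆ Finset.range N, T I ≠ t + T I') :
    ∃ (T' : Finset ℕ → ℝ) (v' : ℝ → ℕ → Fin (k + 1) → ℝ),
      Stage k N (j + 1) T₀ T' (Function.update Ω (j + 1) (t + Ω j)) v' := by
  classical
  refine ⟨fun I => if j + 1 ∈ I ∧ j ∉ I then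
      (if ∃ i ∈ I, i ≤ j then min (T I) (t + T (insert j (I.erase (j + 1))))
        else t + T (insert j (I.erase (j + 1))))
      else T I,
    fun r => Function.update (v r) (j + 1) (v r (j + 1) + Real.exp (-(r * t)) • v r j),
    ?_, ?_, ?_⟩
  · rintro I hI hIN hex
    by_cases hj : j + 1 ∈ I ∧ j ∉ I
    · have hcard : (insert j (I.erase (j + 1))).card = k + 1 := by
        rw [Finset.card_insert_of_notMem (by simp [hj.2]), Finset.card_erase_add_one hj.1, hI]
      have hsub : insert j (I.erase (j + 1)) ⊆ Finset.range N := by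
        have := Finset.mem_range.1 (hIN hj.1)
        refine Finset.insert_subset (Finset.mem_range.2 (by omega)) ?_
        exact (Finset.erase_subset _ _).trans hIN
      have h1 := hs.tendsto _ hcard hsub ⟨j, Finset.mem_insert_self _ _, le_rfl⟩
      simp only [if_pos hj, minor_update_of_mem _ _ hI hj.1 hj.2]
      by_cases hej : ∃ i ∈ I, i ≤ j
      · simp only [if_pos hej]
        exact tendsto_add_mul_exp_min (hs.tendsto I hI hIN hej) h1 (ht I hIN _ hsub)
      · simp only [if_neg hej, hs.eq_zero I hI hej, zero_add]
        refine h1.congr fun r => ?_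
        rw [mul_comm (Real.exp _), mul_assoc, ← Real.exp_add]
        ring_nf
    · simp only [if_neg hj, minor_update_of_not _ _ hI hj]
      refine hs.tendsto I hI hIN ?_
      obtain ⟨i, hi, hij⟩ := hex
      rcases hij.eq_or_lt with h | h
      · exact ⟨j, by subst h; tauto, le_rfl⟩
      · exact ⟨i, hi, by omega⟩
  · intro I hI hex r
    rw [minor_update_of_not _ _ hI fun h => hex ⟨j + 1, h.1, le_rfl⟩]
    exact hs.eq_zero I hI (fun ⟨i, hi, hij⟩ => hex ⟨i, hi, by omega⟩) r
  · intro b hb K hK hbK hcond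
    rcases hb.eq_or_lt with rfl | hb
    · have hKj : ∀ i ∈ K.image (· + 1), j + 1 < i := by
        intro i hi
        obtain ⟨x, hx, rfl⟩ := Finset.mem_image.1 hi
        have := hbK x hx
        show j + 1 < x + 1
        omega
      have hjK : j + 1 ∉ K.image (· + 1) := fun h => (hKj _ h).false
      have h1 : j + 1 ∈ insert (j + 1) (K.image (· + 1)) ∧
          j ∉ insert (j + 1) (K.image (· + 1)) := by
        refine ⟨Finset.mem_insert_self _ _, fun h => ?_⟩
        rcases Finset.mem_insert.1 h with h | h
        · omega
        · have := hKj _ h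
          omega
      have h2 : ¬ ∃ i ∈ insert (j + 1) (K.image (· + 1)), i ≤ j := by
        rintro ⟨i, hi, hij⟩
        rcases Finset.mem_insert.1 hi with h | h
        · omega
        · have := hKj _ h
          omega
      rw [if_pos h1, if_neg h2, Finset.erase_insert hjK, Function.update_self,
        hs.track j le_rfl K hK (fun x hx => by have := hbK x hx; omega)
          (fun x hx hxj => by have := hbK x hx; omega)]
      ring
    · have hb' : b ≤ j := by omega
      have h1 : ¬ (j + 1 ∈ insert b (K.image (· + 1)) ∧ j ∉ insert b (K.image (· + 1))) := by
        rintro ⟨h, h'⟩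
        rcases Finset.mem_insert.1 h with h | h
        · omega
        · obtain ⟨x, hx, hxj⟩ := Finset.mem_image.1 h
          obtain rfl : x = j := by simpa using hxj
          exact h' (hcond x hx le_rfl)
      rw [if_neg h1, Function.update_of_ne (by omega)]
      exact hs.track b hb' K hK hbK fun x hx hxj => hcond x hx (by omega)

theorem exists_stage {k N : ℕ} {T₀ : Finset ℕ → ℝ} (h : IsRealizable k N T₀) (Ω : ℕ → ℝ)
    (hΩ : Ω 0 = 0) {δ : ℝ} (hδ : 0 < δ) (j : ℕ) :
    ∃ (T : Finset ℕ → ℝ) (Ω' : ℕ → ℝ) (v : ℝ → ℕ → Fin (k + 1) → ℝ),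
      Stage k (N + 1) j T₀ T Ω' v ∧ ∀ b ≤ j, |Ω' b - Ω b| < δ := by
  induction j with
  | zero =>
    obtain ⟨T, v, hs⟩ := stage_zero h
    refine ⟨T, 0, v, hs, fun b hb => ?_⟩
    obtain rfl : b = 0 := by omega
    simpa [hΩ] using hδ
  | succ j ih =>
    obtain ⟨T, Ω', v, hs, hclose⟩ := ih
    let bad : Finset ℝ := ((Finset.range (N + 1)).powerset ×ˢ (Finset.range (N + 1)).powerset).image
      fun q => T q.1 - T q.2
    obtain ⟨t, ht, htbad⟩ := (Set.Ioo_infinite (show Ω (j + 1) - Ω' j - δ < Ω (j + 1) - Ω' j + δ by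
      linarith)).exists_notMem_finset bad
    obtain ⟨T', v', hs'⟩ := hs.succ (t := t) fun I hI I' hI' heq => htbad
      (Finset.mem_image.2 ⟨(I, I'), Finset.mem_product.2
        ⟨Finset.mem_powerset.2 hI, Finset.mem_powerset.2 hI'⟩, by simp only; linarith⟩)
    refine ⟨T', _, v', hs', fun b hb => ?_⟩
    rcases hb.eq_or_lt with rfl | hb
    · rw [Function.update_self, abs_lt]
      constructor <;> linarith [ht.1, ht.2]
    · rw [Function.update_of_ne (by omega)]
      exact hclose b (by omega)

/-- The index sets whose values determine a positive tropical Plücker vector. -/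
def rectangle (m k b c : ℕ) : Finset ℕ :=
  Finset.Ico b (b + c) ∪ Finset.Ico (m + c) (m + k)

theorem mem_rectangle {m k b c x : ℕ} :
    x ∈ rectangle m k b c ↔ (b ≤ x ∧ x < b + c) ∨ (m + c ≤ x ∧ x < m + k) := by
  simp [rectangle]

theorem card_rectangle {m k b c : ℕ} (hb : b ≤ m) (hc : c ≤ k) : (rectangle m k b c).card = k := by
  rw [rectangle, Finset.card_union_of_disjoint, Nat.card_Ico, Nat.card_Ico]
  · omega
  · rw [Finset.disjoint_left]
    intro x h1 h2
    rw [Finset.mem_Ico] at h1 h2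
    omega

theorem rectangle_succ {m k b c : ℕ} :
    rectangle m (k + 1) b (c + 1) = insert b ((rectangle m k b c).image (· + 1)) := by
  ext x
  simp only [Finset.mem_insert, Finset.mem_image, mem_rectangle]
  constructor
  · intro h
    by_cases hx : x = b
    · exact Or.inl hx
    · exact Or.inr ⟨x - 1, by omega, by omega⟩
  · rintro (rfl | ⟨y, hy, rfl⟩) <;> omega

theorem rectangle_zero {m k b : ℕ} : rectangle m k b 0 = rectangle m k m 0 := by
  ext x
  simp only [mem_rectangle]
  omega

theorem rectangle_last {m k c : ℕ} (hc : c ≤ k) : rectangle m k m c = rectangle m k m 0 := by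
  ext x
  simp only [mem_rectangle]
  omega

/-- The values on rectangles of a realizable vector can be prescribed up to a small error. -/
theorem exists_isRealizable (m k : ℕ) (Y : ℕ → ℕ → ℝ) (h0 : ∀ b ≤ m, Y b 0 = Y m 0)
    (hm : ∀ c ≤ k, Y m c = Y m 0) (hk : Y 0 k = 0) {δ : ℝ} (hδ : 0 < δ) :
    ∃ T : Finset ℕ → ℝ, IsRealizable k (m + k) T ∧
      ∀ b ≤ m, ∀ c ≤ k, |T (rectangle m k b c) - Y b c| < δ := by
  induction k generalizing Y δ with
  | zero =>
    refine ⟨0, ⟨fun _ _ => 0, fun I hI _ => ?_⟩, fun b hb c hc => ?_⟩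
    · refine tendsto_const_nhds.congr fun r => ?_
      rw [minor, dif_pos hI, Matrix.det_isEmpty]
      simp
    · obtain rfl : c = 0 := by omega
      have : Y b 0 = 0 := by rw [h0 b hb, ← h0 0 (Nat.zero_le m), hk]
      simpa [this] using hδ
  | succ k ih =>
    obtain ⟨T₀, hT₀, hclose⟩ := ih (fun b c => Y b (c + 1) - (Y b 1 - Y 0 1))
      (fun b _ => by ring) (fun c hc => by
        simp only [hm (c + 1) (by omega), hm (0 + 1) (by omega)]) (by simp [hk]) (half_pos hδ)
    obtain ⟨T, Ω', v, hs, hΩ⟩ := exists_stage hT₀ (fun b => Y b 1 - Y 0 1) (by ring)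
      (half_pos hδ) m
    have main : ∀ b ≤ m, ∀ c ≤ k, |T (rectangle m (k + 1) b (c + 1)) - Y b (c + 1)| < δ := by
      intro b hb c hc
      have h1 := abs_lt.1 (hclose b hb c hc)
      have h2 := abs_lt.1 (hΩ b hb)
      rw [rectangle_succ, hs.track b hb _ (card_rectangle hb hc), abs_lt]
      · constructor <;> linarith [h1.1, h1.2, h2.1, h2.2]
      · intro x hx
        rw [mem_rectangle] at hx
        omega
      · intro x hx hxm
        rw [mem_rectangle] at hx
        by_cases hxb : x = b
        · exact Finset.mem_insert.2 (Or.inl hxb)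
        · refine Finset.mem_insert_of_mem (Finset.mem_image.2 ⟨x - 1, ?_, ?_⟩)
          · rw [mem_rectangle]; omega
          · show x - 1 + 1 = x
            omega
    refine ⟨T, ⟨v, fun I hI hIN => hs.tendsto I hI hIN ?_⟩, fun b hb c hc => ?_⟩
    · by_contra hcon
      push Not at hcon
      have : I ⊆ Finset.Ico (m + 1) (m + (k + 1)) := fun x hx => Finset.mem_Ico.2
        ⟨hcon x hx, Finset.mem_range.1 (hIN hx)⟩
      have := Finset.card_le_card this
      rw [Nat.card_Ico] at this
      omega
    · rcases Nat.eq_zero_or_pos c with rfl | hc0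
      · rw [rectangle_zero, ← rectangle_last (show 0 + 1 ≤ k + 1 by omega), h0 b hb,
          ← hm (0 + 1) (by omega)]
        exact main m le_rfl 0 (Nat.zero_le k)
      · obtain ⟨c, rfl⟩ : ∃ c', c = c' + 1 := ⟨c - 1, by omega⟩
        exact main b hb c (by omega)

theorem eq_zero_of_tendsto_mul_exp {g : ℝ → ℝ} {x L : ℝ}
    (hg : Filter.Tendsto g Filter.atTop (nhds 1))
    (h : Filter.Tendsto (fun r => g r * Real.exp (r * x)) Filter.atTop (nhds L)) (hL : L ≠ 0) :
    x = 0 := by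
  rcases lt_trichotomy x 0 with hx | hx | hx
  · have := hg.mul (tendsto_exp_mul_of_neg hx)
    rw [mul_zero] at this
    exact absurd (tendsto_nhds_unique h this) hL
  · exact hx
  · have : Filter.Tendsto (fun r : ℝ => Real.exp (r * x)) Filter.atTop Filter.atTop :=
      Real.tendsto_exp_atTop.comp (Filter.tendsto_id.atTop_mul_const hx)
    exact absurd h (not_tendsto_nhds_of_tendsto_atTop (hg.pos_mul_atTop one_pos this) L)

theorem IsRealizable.plucker {k N : ℕ} {T : Finset ℕ → ℝ} (hT : IsRealizable k N T)
    {S : Finset ℕ} (hS : S.card + 2 = k) (hSN : S ⊆ Finset.range N) {a b c d : ℕ} (hab : a < b)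
    (hbc : b < c) (hcd : c < d) (hdN : d < N) (ha : a ∉ S) (hb : b ∉ S) (hc : c ∉ S)
    (hd : d ∉ S) :
    T (insert a (insert c S)) + T (insert b (insert d S)) =
      min (T (insert a (insert b S)) + T (insert c (insert d S)))
        (T (insert a (insert d S)) + T (insert b (insert c S))) ∧
    T (insert a (insert b S)) + T (insert c (insert d S)) ≠
      T (insert a (insert d S)) + T (insert b (insert c S)) := by
  obtain ⟨v, hv⟩ := hT
  have pair : ∀ {x y : ℕ}, x < y → y < N → x ∉ S → y ∉ S →
      Filter.Tendsto (fun r => minor (v r) (insert x (insert y S)) *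
        Real.exp (r * T (insert x (insert y S)))) Filter.atTop (nhds 1) := by
    intro x y hxy hy hxS hyS
    refine hv _ ?_ ?_
    · rw [Finset.card_insert_of_notMem, Finset.card_insert_of_notMem hyS]
      · omega
      · simp [hxS, hxy.ne]
    · exact Finset.insert_subset (Finset.mem_range.2 (by omega))
        (Finset.insert_subset (Finset.mem_range.2 hy) hSN)
  have quad : ∀ {I J : Finset ℕ},
      Filter.Tendsto (fun r => minor (v r) I * Real.exp (r * T I)) Filter.atTop (nhds 1) →
      Filter.Tendsto (fun r => minor (v r) J * Real.exp (r * T J)) Filter.atTop (nhds 1) →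
      Filter.Tendsto (fun r => minor (v r) I * minor (v r) J * Real.exp (r * (T I + T J)))
        Filter.atTop (nhds 1) := by
    intro I J hI hJ
    have := hI.mul hJ
    rw [mul_one] at this
    refine this.congr fun r => ?_
    rw [mul_add, Real.exp_add]
    ring
  have h1 := quad (pair hab (by omega) ha hb) (pair hcd hdN hc hd)
  have h2 := quad (pair (hab.trans hbc) (by omega) ha hc) (pair (hbc.trans hcd) hdN hb hd)
  have h3 := quad (pair (hab.trans (hbc.trans hcd)) hdN ha hd) (pair hbc (by omega) hb hc)
  simp only [fun r => minor_plucker (v r) hS hab hbc hcd ha hb hc hd] at h2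
  generalize T (insert a (insert b S)) + T (insert c (insert d S)) = x at *
  generalize T (insert a (insert c S)) + T (insert b (insert d S)) = y at *
  generalize T (insert a (insert d S)) + T (insert b (insert c S)) = z at *
  have key : ∀ {w L : ℝ}, L ≠ 0 → Filter.Tendsto (fun r =>
      (minor (v r) (insert a (insert b S)) * minor (v r) (insert c (insert d S)) +
        minor (v r) (insert a (insert d S)) * minor (v r) (insert b (insert c S))) *
        Real.exp (r * w)) Filter.atTop (nhds L) → y = w := by
    intro w L hL hw
    refine (sub_eq_zero.1 (eq_zero_of_tendsto_mul_exp h2 (hw.congr fun r => ?_) hL)).symm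
    rw [mul_assoc, ← Real.exp_add]
    ring_nf
  by_cases hne : x = z
  · subst hne
    have h := h1.add h3
    simp only [← add_mul] at h
    obtain rfl := key (by norm_num) h
    have := tendsto_nhds_unique h h2
    norm_num at this
  · refine ⟨key one_ne_zero ?_, hne⟩
    simpa using tendsto_add_mul_exp_min (t := 0) h1 h3 (by simpa using hne)

/-- The three-term positive tropical Plücker relations for subsets of `{0, …, N - 1}`. -/
def ThreeTerm (k N : ℕ) (T : Finset ℕ → ℝ) : Prop :=
  ∀ S : Finset ℕ, S.card + 2 = k → S ⊆ Finset.range N → ∀ a b c d : ℕ, a < b → b < c → c < d →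
    d < N → a ∉ S → b ∉ S → c ∉ S → d ∉ S →
    T (insert a (insert c S)) + T (insert b (insert d S)) =
      min (T (insert a (insert b S)) + T (insert c (insert d S)))
        (T (insert a (insert d S)) + T (insert b (insert c S)))

theorem IsRealizable.threeTerm {k N : ℕ} {T : Finset ℕ → ℝ} (hT : IsRealizable k N T) :
    ThreeTerm k N T := fun _ hS hSN _ _ _ _ hab hbc hcd hdN ha hb hc hd =>
  (hT.plucker hS hSN hab hbc hcd hdN ha hb hc hd).1

theorem ThreeTerm.tendsto {k N : ℕ} {T : ℕ → Finset ℕ → ℝ} {T' : Finset ℕ → ℝ}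
    (hT : ∀ i, ThreeTerm k N (T i)) (hT' : ThreeTerm k N T') {S : Finset ℕ} (hS : S.card + 2 = k)
    (hSN : S ⊆ Finset.range N) {a b c d : ℕ} (hab : a < b) (hbc : b < c) (hcd : c < d)
    (hdN : d < N) (ha : a ∉ S) (hb : b ∉ S) (hc : c ∉ S) (hd : d ∉ S)
    (h : ∀ I ∈ ({insert b (insert d S), insert a (insert b S), insert c (insert d S),
      insert a (insert d S), insert b (insert c S)} : Set (Finset ℕ)),
      Filter.Tendsto (fun i => T i I) Filter.atTop (nhds (T' I))) :
    Filter.Tendsto (fun i => T i (insert a (insert c S))) Filter.atTop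
      (nhds (T' (insert a (insert c S)))) := by
  have hmin := ((((h _ (by simp)).add (h (insert c (insert d S)) (by simp))).min
    ((h (insert a (insert d S)) (by simp)).add (h (insert b (insert c S)) (by simp)))).sub
    (h (insert b (insert d S)) (by simp)) : Filter.Tendsto (fun i =>
      min (T i (insert a (insert b S)) + _) _ - _) _ _)
  rw [← hT' S hS hSN a b c d hab hbc hcd hdN ha hb hc hd, add_sub_cancel_right] at hmin
  refine hmin.congr fun i => ?_
  rw [← hT i S hS hSN a b c d hab hbc hcd hdN ha hb hc hd, add_sub_cancel_right]

theorem tendsto_of_tendsto_rectangle {m k : ℕ} {T : ℕ → Finset ℕ → ℝ} {T' : Finset ℕ → ℝ}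
    (hT : ∀ i, ThreeTerm k (m + k) (T i)) (hT' : ThreeTerm k (m + k) T')
    (h : ∀ b ≤ m, ∀ c ≤ k, Filter.Tendsto (fun i => T i (rectangle m k b c)) Filter.atTop
      (nhds (T' (rectangle m k b c)))) {c : ℕ} (hck : c ≤ k) :
    ∀ J : Finset ℕ, J.card = c → J ⊆ Finset.range (m + c) →
      Filter.Tendsto (fun i => T i (J ∪ Finset.Ico (m + c) (m + k))) Filter.atTop
        (nhds (T' (J ∪ Finset.Ico (m + c) (m + k)))) := by
  induction c with
  | zero =>
    intro J hJ _
    obtain rfl := Finset.card_eq_zero.1 hJ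
    simpa [rectangle] using h m le_rfl 0 (Nat.zero_le k)
  | succ c ih =>
    have ih := ih (by omega)
    have hlast : ∀ J : Finset ℕ, J.card = c + 1 → J ⊆ Finset.range (m + (c + 1)) → m + c ∈ J →
        Filter.Tendsto (fun i => T i (J ∪ Finset.Ico (m + (c + 1)) (m + k))) Filter.atTop
          (nhds (T' (J ∪ Finset.Ico (m + (c + 1)) (m + k)))) := by
      intro J hJ hJm hmem
      have heq : J.erase (m + c) ∪ Finset.Ico (m + c) (m + k) =
          J ∪ Finset.Ico (m + (c + 1)) (m + k) := by
        ext x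
        simp only [Finset.mem_union, Finset.mem_erase, Finset.mem_Ico]
        by_cases hx : x = m + c
        · subst hx
          simp only [hmem, true_or, iff_true]
          omega
        · constructor <;> rintro (hh | hh)
          · exact Or.inl hh.2
          · exact Or.inr (by omega)
          · exact Or.inl ⟨hx, hh⟩
          · exact Or.inr (by omega)
      rw [← heq]
      refine ih _ (by rw [Finset.card_erase_of_mem hmem, hJ]; rfl) fun x hx => ?_
      have h1 := Finset.mem_erase.1 hx
      have h2 := Finset.mem_range.1 (hJm h1.2)
      exact Finset.mem_range.2 (by omega)
    have span : ∀ L : ℕ, ∀ a, ∀ J : Finset ℕ, J.card = c + 1 → J ⊆ Finset.range (m + c) →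
        J ⊆ Finset.Ico a (a + L) →
        Filter.Tendsto (fun i => T i (J ∪ Finset.Ico (m + (c + 1)) (m + k))) Filter.atTop
          (nhds (T' (J ∪ Finset.Ico (m + (c + 1)) (m + k)))) := by
      intro L
      induction L with
      | zero =>
        intro a J hJ _ hJa
        have := Finset.card_le_card hJa
        simp [hJ] at this
      | succ L ihL =>
        intro a J hJ hJm hJa
        by_cases haJ : a ∈ J
        swap
        · refine ihL (a + 1) J hJ hJm fun x hx => ?_
          have h1 := Finset.mem_Ico.1 (hJa hx)
          have h2 : x ≠ a := fun hh => haJ (hh ▸ hx)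
          exact Finset.mem_Ico.2 (by omega)
        by_cases hqJ : a + L ∈ J
        swap
        · refine ihL a J hJ hJm fun x hx => ?_
          have h1 := Finset.mem_Ico.1 (hJa hx)
          have h2 : x ≠ a + L := fun hh => hqJ (hh ▸ hx)
          exact Finset.mem_Ico.2 (by omega)
        have hqm := Finset.mem_range.1 (hJm hqJ)
        by_cases hfull : Finset.Ico a (a + (L + 1)) ⊆ J
        · have hJeq : J = Finset.Ico a (a + (L + 1)) := hJa.antisymm hfull
          have hL : L + 1 = c + 1 := by
            rw [← hJ, hJeq, Nat.card_Ico]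
            omega
          rw [hJeq, hL]
          exact h a (by omega) (c + 1) hck
        obtain ⟨b, hb, hbJ⟩ := Finset.not_subset.1 hfull
        rw [Finset.mem_Ico] at hb
        have hba : b ≠ a := fun hh => hbJ (hh ▸ haJ)
        have hbq : b ≠ a + L := fun hh => hbJ (hh ▸ hqJ)
        obtain ⟨S, hSdef⟩ : ∃ S, S = (J.erase a).erase (a + L) := ⟨_, rfl⟩
        have hqa : a + L ∈ J.erase a := Finset.mem_erase.2 ⟨by omega, hqJ⟩
        have hScard : S.card + 2 = c + 1 := by
          have h1 := Finset.card_erase_add_one hqa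
          have h2 := Finset.card_erase_add_one haJ
          rw [hSdef]
          omega
        have hSJ : ∀ x ∈ S, a < x ∧ x < a + L ∧ x < m + c ∧ x ∈ J := by
          intro x hx
          rw [hSdef, Finset.mem_erase, Finset.mem_erase] at hx
          have h1 := Finset.mem_Ico.1 (hJa hx.2.2)
          have h2 := Finset.mem_range.1 (hJm hx.2.2)
          exact ⟨by omega, by omega, h2, hx.2.2⟩
        have hJS : insert a (insert (a + L) S) = J := by
          rw [hSdef, Finset.insert_erase hqa, Finset.insert_erase haJ]
        have haS : a ∉ S := fun hh => (hSJ a hh).1.false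
        have hqS : a + L ∉ S := fun hh => (hSJ _ hh).2.1.false
        have hbS : b ∉ S := fun hh => hbJ (hSJ b hh).2.2.2
        have hdS : m + c ∉ S := fun hh => (hSJ _ hh).2.2.1.false
        obtain ⟨E, hE⟩ : ∃ E, E = Finset.Ico (m + (c + 1)) (m + k) := ⟨_, rfl⟩
        have hEmem : ∀ x ∈ E, m + c < x ∧ x < m + k := fun x hx => by
          rw [hE, Finset.mem_Ico] at hx
          omega
        have hdisj : Disjoint S E := Finset.disjoint_left.2 fun x h1 h2 => by
          have := hSJ x h1
          have := hEmem x h2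
          omega
        have hnE : ∀ x ≤ m + c, x ∉ S → x ∉ S ∪ E := fun x hx hxS hxE => by
          rcases Finset.mem_union.1 hxE with hh | hh
          · exact hxS hh
          · have := hEmem x hh
            omega
        have hpair : ∀ {x y : ℕ}, x < y → x ∉ S → y ∉ S → (insert x (insert y S)).card = c + 1 := by
          intro x y hxy hx hy
          rw [Finset.card_insert_of_notMem (by simp [hx, hxy.ne]),
            Finset.card_insert_of_notMem hy]
          omega
        have hpairs : ∀ {x y M : ℕ}, x < M → y < M → m + c ≤ M →
            insert x (insert y S) ⊆ Finset.range M := by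
          intro x y M hx hy hM
          refine Finset.insert_subset (Finset.mem_range.2 hx)
            (Finset.insert_subset (Finset.mem_range.2 hy) fun z hz => ?_)
          have := hSJ z hz
          exact Finset.mem_range.2 (by omega)
        have hwith : ∀ x < m + c, x ∉ S → Filter.Tendsto (fun i =>
            T i (insert x (insert (m + c) (S ∪ E)))) Filter.atTop
            (nhds (T' (insert x (insert (m + c) (S ∪ E))))) := by
          intro x hx hxS
          have := hlast (insert x (insert (m + c) S)) (hpair hx hxS hdS)
            (hpairs (by omega) (by omega) (by omega)) (by simp)
          rwa [← hE, Finset.insert_union, Finset.insert_union] at this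
        have hless : ∀ x y a', x < y → y < m + c → x ∉ S → y ∉ S → a' ≤ x → y < a' + L →
            a' ≤ a + 1 → a ≤ a' → Filter.Tendsto (fun i =>
            T i (insert x (insert y (S ∪ E)))) Filter.atTop
            (nhds (T' (insert x (insert y (S ∪ E))))) := by
          intro x y a' hxy hy hxS hyS hx' hy' ha' ha''
          have := ihL a' (insert x (insert y S)) (hpair hxy hxS hyS)
            (hpairs (by omega) (by omega) le_rfl)
            (Finset.insert_subset (Finset.mem_Ico.2 (by omega))
            (Finset.insert_subset (Finset.mem_Ico.2 (by omega)) fun z hz => Finset.mem_Ico.2 (by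
              have := hSJ z hz
              omega)))
          rwa [← hE, Finset.insert_union, Finset.insert_union] at this
        rw [← hJS, ← hE, Finset.insert_union, Finset.insert_union]
        refine ThreeTerm.tendsto hT hT' (b := b) (d := m + c) ?_ ?_ (by omega) (by omega) hqm
          (by omega) (hnE _ (by omega) haS) (hnE _ (by omega) hbS) (hnE _ (by omega) hqS)
          (hnE _ le_rfl hdS) ?_
        · rw [Finset.card_union_of_disjoint hdisj, hE, Nat.card_Ico]
          omega
        · intro x hx
          rcases Finset.mem_union.1 hx with hh | hh
          · have := hSJ x hh
            exact Finset.mem_range.2 (by omega)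
          · exact Finset.mem_range.2 (hEmem x hh).2
        · rintro I (rfl | rfl | rfl | rfl | rfl)
          · exact hwith b (by omega) hbS
          · exact hless a b a (by omega) (by omega) haS hbS le_rfl (by omega) (by omega) le_rfl
          · exact hwith (a + L) hqm hqS
          · exact hwith a (by omega) haS
          · exact hless b (a + L) (a + 1) (by omega) (by omega) hbS hqS (by omega) (by omega)
              le_rfl (by omega)
    intro J hJ hJm
    by_cases hmem : m + c ∈ J
    · exact hlast J hJ hJm hmem
    · have hJm' : J ⊆ Finset.range (m + c) := fun x hx => by
        have h1 := Finset.mem_range.1 (hJm hx)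
        have h2 : x ≠ m + c := fun hh => hmem (hh ▸ hx)
        exact Finset.mem_range.2 (by omega)
      refine span (m + c) 0 J hJ hJm' ?_
      rwa [zero_add, ← Finset.range_eq_Ico]

/-- The part of `I` below `n`, as a set of elements of `Fin n`. -/
def toFin (n : ℕ) (I : Finset ℕ) : Finset (Fin n) :=
  Finset.univ.filter fun i => (i : ℕ) ∈ I

theorem toFin_map {n : ℕ} (J : Finset (Fin n)) : toFin n (J.map Fin.valEmbedding) = J := by
  ext i
  simp [toFin, Fin.val_inj]

theorem map_toFin {n : ℕ} {I : Finset ℕ} (hI : I ⊆ Finset.range n) :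
    (toFin n I).map Fin.valEmbedding = I := by
  ext x
  simp only [toFin, Finset.mem_map, Finset.mem_filter, Finset.mem_univ, true_and,
    Fin.valEmbedding_apply]
  exact ⟨by rintro ⟨i, hi, rfl⟩; exact hi, fun hx => ⟨⟨x, Finset.mem_range.1 (hI hx)⟩, hx, rfl⟩⟩

theorem toFin_insert {n a b : ℕ} (ha : a < n) (hb : b < n) (S : Finset ℕ) :
    toFin n (insert a (insert b S)) = toFin n S ∪ {⟨a, ha⟩, ⟨b, hb⟩} := by
  ext i
  simp only [toFin, Finset.mem_filter, Finset.mem_univ, true_and, Finset.mem_insert,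
    Finset.mem_union, Finset.mem_singleton, Fin.ext_iff]
  tauto

theorem map_union_pair {n : ℕ} (S : Finset (Fin n)) (a b : Fin n) :
    (S ∪ {a, b}).map Fin.valEmbedding =
      insert (a : ℕ) (insert (b : ℕ) (S.map Fin.valEmbedding)) := by
  ext x
  simp only [Finset.mem_map, Finset.mem_union, Finset.mem_insert, Finset.mem_singleton,
    Fin.valEmbedding_apply]
  constructor
  · rintro ⟨i, hi | rfl | rfl, rfl⟩
    · exact Or.inr (Or.inr ⟨i, hi, rfl⟩)
    · exact Or.inl rfl
    · exact Or.inr (Or.inl rfl)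
  · rintro (rfl | rfl | ⟨i, hi, rfl⟩)
    · exact ⟨a, by simp, rfl⟩
    · exact ⟨b, by simp, rfl⟩
    · exact ⟨i, Or.inl hi, rfl⟩

theorem IsPosTropPlucker.threeTerm {n k : ℕ} {P : Finset (Fin n) → ℝ}
    (hP : IsPosTropPlucker n k P) (C : ℝ) : ThreeTerm k n fun I => P (toFin n I) - C := by
  intro S hS hSn a b c d hab hbc hcd hd haS hbS hcS hdS
  have hcard : (toFin n S).card + 2 = k := by
    rw [← Finset.card_map Fin.valEmbedding, map_toFin hSn, hS]
  have hmem : ∀ {x : ℕ} (hx : x < n), x ∉ S → (⟨x, hx⟩ : Fin n) ∉ toFin n S := by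
    intro x hx hxS
    simpa [toFin] using hxS
  have hc : c < n := hcd.trans hd
  have hb : b < n := hbc.trans hc
  have ha : a < n := hab.trans hb
  have := hP (toFin n S) hcard ⟨a, ha⟩ ⟨b, hb⟩ ⟨c, hc⟩ ⟨d, hd⟩ hab hbc hcd (hmem ha haS)
    (hmem hb hbS) (hmem hc hcS) (hmem hd hdS)
  simp only [toFin_insert ha hb, toFin_insert ha hc, toFin_insert ha hd, toFin_insert hb hc,
    toFin_insert hb hd, toFin_insert hc hd]
  rcases this with ⟨h1, h2⟩ | ⟨h1, h2⟩
  · rw [min_eq_left (by linarith)]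
    linarith
  · rw [min_eq_right (by linarith)]
    linarith

theorem IsRealizable.isPosTropPlucker {n k : ℕ} {T : Finset ℕ → ℝ} (hT : IsRealizable k n T)
    (C : ℝ) : IsPosTropPlucker n k (fun J => T (J.map Fin.valEmbedding) + C) ∧
      OctahedraSubdivided n k (fun J => T (J.map Fin.valEmbedding) + C) := by
  have key := fun (S : Finset (Fin n)) (hS : S.card + 2 = k) (a b c d : Fin n) (hab : a < b)
    (hbc : b < c) (hcd : c < d) (ha : a ∉ S) (hb : b ∉ S) (hc : c ∉ S) (hd : d ∉ S) =>
    hT.plucker (S := S.map Fin.valEmbedding) (by rwa [Finset.card_map])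
      (fun x hx => by
        obtain ⟨i, _, rfl⟩ := Finset.mem_map.1 hx
        exact Finset.mem_range.2 i.2)
      (Fin.lt_def.1 hab) (Fin.lt_def.1 hbc) (Fin.lt_def.1 hcd) d.2
      ((Finset.mem_map' Fin.valEmbedding).not.2 ha) ((Finset.mem_map' Fin.valEmbedding).not.2 hb)
      ((Finset.mem_map' Fin.valEmbedding).not.2 hc) ((Finset.mem_map' Fin.valEmbedding).not.2 hd)
  simp only [← map_union_pair] at key
  refine ⟨fun S hS a b c d hab hbc hcd ha hb hc hd => ?_,
    fun S hS a b c d hab hbc hcd ha hb hc hd heq => ?_⟩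
  · obtain ⟨h, -⟩ := key S hS a b c d hab hbc hcd ha hb hc hd
    rcases le_total (T ((S ∪ {a, b}).map Fin.valEmbedding) + T ((S ∪ {c, d}).map Fin.valEmbedding))
      (T ((S ∪ {a, d}).map Fin.valEmbedding) + T ((S ∪ {b, c}).map Fin.valEmbedding)) with hle | hle
    · rw [min_eq_left hle] at h
      exact Or.inl ⟨by linarith, by linarith⟩
    · rw [min_eq_right hle] at h
      exact Or.inr ⟨by linarith, by linarith⟩
  · exact (key S hS a b c d hab hbc hcd ha hb hc hd).2 (by linarith)

/-- Positive tropical Plücker vectors subdividing every octahedron are dense. -/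
theorem IsPosTropPlucker.exists_tendsto {n k : ℕ} (hkn : k < n) {P : Finset (Fin n) → ℝ}
    (hP : IsPosTropPlucker n k P) : ∃ Q : ℕ → Finset (Fin n) → ℝ,
      (∀ i, IsPosTropPlucker n k (Q i) ∧ OctahedraSubdivided n k (Q i)) ∧
      ∀ I : Finset (Fin n), I.card = k →
        Filter.Tendsto (fun i => Q i I) Filter.atTop (nhds (P I)) := by
  obtain ⟨m, rfl⟩ : ∃ m, n = m + k := ⟨n - k, by omega⟩
  obtain ⟨C, hC⟩ : ∃ C, C = P (toFin (m + k) (rectangle m k 0 k)) := ⟨_, rfl⟩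
  have happrox := fun i : ℕ => exists_isRealizable m k
    (fun b c => P (toFin (m + k) (rectangle m k b c)) - C)
    (fun b _ => by simp only [rectangle_zero (b := b)])
    (fun c hc => by simp only [rectangle_last hc]) (by simp [hC])
    (δ := 1 / ((i : ℝ) + 1)) (by positivity)
  choose T hT hclose using happrox
  have hrect : ∀ b ≤ m, ∀ c ≤ k, Filter.Tendsto (fun i => T i (rectangle m k b c)) Filter.atTop
      (nhds (P (toFin (m + k) (rectangle m k b c)) - C)) := by
    intro b hb c hc
    rw [tendsto_iff_dist_tendsto_zero]
    exact squeeze_zero (fun i => dist_nonneg) (fun i => (hclose i b hb c hc).le)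
      tendsto_one_div_add_atTop_nhds_zero_nat
  refine ⟨fun i J => T i (J.map Fin.valEmbedding) + C, fun i => (hT i).isPosTropPlucker C,
    fun I hI => ?_⟩
  have := tendsto_of_tendsto_rectangle (fun i => (hT i).threeTerm) (hP.threeTerm C) hrect le_rfl
    (I.map Fin.valEmbedding) (by rwa [Finset.card_map]) (fun x hx => by
      obtain ⟨i, _, rfl⟩ := Finset.mem_map.1 hx
      exact Finset.mem_range.2 i.2)
  rw [Finset.Ico_self, Finset.union_empty, toFin_map] at this
  simpa using this.add_const C

/-- A regular positroidal subdivision `D_P` is finest if and only if every octahedron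
in it is subdivided, i.e. the two "non-crossing" tropical Plücker expressions are never
equal. -/
theorem stmt_8 (k n : ℕ) (hk : 0 < k) (hkn : k < n) (P : Finset (Fin n) → ℝ)
    (hP : IsPosTropPlucker n k P) :
    IsFinest n k P ↔
      ∀ S : Finset (Fin n), S.card + 2 = k →
        ∀ a b c d : Fin n, a < b → b < c → c < d →
          a ∉ S → b ∉ S → c ∉ S → d ∉ S →
          P (S ∪ {a, b}) + P (S ∪ {c, d}) ≠ P (S ∪ {a, d}) + P (S ∪ {b, c}) := by
  refine ⟨fun hf => ?_, fun h => OctahedraSubdivided.isFinest hk hkn hP h⟩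
  obtain ⟨Q, hQ, hQP⟩ := hP.exists_tendsto hkn
  obtain ⟨i, hi⟩ := exists_refines_of_tendsto hk hkn hQP
  exact hf.octahedraSubdivided hP (hQ i).1 (hQ i).2 hi
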